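/- arXiv:1602.00264 — 9 statements merged into one kernel-verified Lean document; each statement's English description precedes it below -/
import Mathlib

section
/- Let P be a C¹ real function (on an interval containing the relevant values), and let f, g, a, c be C¹ functions on [0,∞). Let V(X,t) and Γ(X,t) be C¹ functions on [0,∞)×[0,∞) such that P(Γ(X,t)) is C¹ on [0,∞)×[0,∞). Then the pair (V,Γ) is a classical solution of the p-system V_t − (P(Γ))_X = 0, Γ_t − V_X = 0 on (0,∞)×(0,∞) with initial conditions V(X,0)=f(X), Γ(X,0)=g(X) and boundary condition P(Γ(0,t)) + a(t)V(0,t) = c(t), if and only if for every C¹ compactly supported test function ψ:[0,∞)×[0,∞)→ℝ with ψ(0,t)=0 for all t one has −∫₀^∞ g(X)ψ(X,0)dX − ∫₀^∞∫₀^∞ Γ ψ_t dt dX + ∫₀^∞∫₀^∞ V ψ_X dX dt = 0, and for every C¹ compactly supported test function φ:[0,∞)×[0,∞)→ℝ one has −∫₀^∞ f(X)φ(X,0)dX − ∫₀^∞∫₀^∞ V φ_t dt dX + ∫₀^∞ c(t)φ(0,t)dt + ∫₀^∞∫₀^∞ P(Γ) φ_X dX dt − ∫₀^∞ g(X)a(0)φ(X,0)dX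 − ∫₀^∞∫₀^∞ (a(t)φ(X,t))_t Γ dt dX + ∫₀^∞∫₀^∞ a(t)φ_X(X,t) V dX dt = 0. -/
open Set MeasureTheory Function

/-- The closed first quadrant. -/
abbrev closedQuadrant : Set (ℝ × ℝ) := Ici 0 ×ˢ Ici 0

/-- The open first quadrant. -/
abbrev openQuadrant : Set (ℝ × ℝ) := Ioi 0 ×ˢ Ioi 0

/-- `U` is continuous on the closed quadrant and has, on the open quadrant, partial derivatives
`UX` and `Ut` that are continuous on the closed quadrant. -/
structure HasPartials (U UX Ut : ℝ × ℝ → ℝ) : Prop where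
  cont : ContinuousOn U closedQuadrant
  contX : ContinuousOn UX closedQuadrant
  contT : ContinuousOn Ut closedQuadrant
  derivX : ∀ X t : ℝ, 0 < X → 0 < t → HasDerivAt (fun Y => U (Y, t)) (UX (X, t)) X
  derivT : ∀ X t : ℝ, 0 < X → 0 < t → HasDerivAt (fun τ => U (X, τ)) (Ut (X, t)) t

lemma openQuadrant_subset_closedQuadrant : openQuadrant ⊆ closedQuadrant :=
  prod_mono Ioi_subset_Ici_self Ioi_subset_Ici_self

lemma ContDiffOn.exists_hasPartials {U : ℝ × ℝ → ℝ} (hU : ContDiffOn ℝ 1 U closedQuadrant) :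
    ∃ UX Ut, HasPartials U UX Ut := by
  have hc : ContinuousOn (fderivWithin ℝ U closedQuadrant) closedQuadrant :=
    hU.continuousOn_fderivWithin ((uniqueDiffOn_Ici 0).prod (uniqueDiffOn_Ici 0)) le_rfl
  have hd : ∀ X t : ℝ, 0 < X → 0 < t →
      HasFDerivAt U (fderivWithin ℝ U closedQuadrant (X, t)) (X, t) := by
    intro X t hX ht
    exact (hU.differentiableOn one_ne_zero (X, t) ⟨hX.le, ht.le⟩).hasFDerivWithinAt.hasFDerivAt
      (prod_mem_nhds (Ici_mem_nhds hX) (Ici_mem_nhds ht))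
  refine ⟨fun p => fderivWithin ℝ U closedQuadrant p (1, 0),
    fun p => fderivWithin ℝ U closedQuadrant p (0, 1), hU.continuousOn,
    hc.clm_apply continuousOn_const, hc.clm_apply continuousOn_const, ?_, ?_⟩
  · intro X t hX ht
    exact (hd X t hX ht).comp_hasDerivAt X ((hasDerivAt_id X).prodMk (hasDerivAt_const X t))
  · intro X t hX ht
    exact (hd X t hX ht).comp_hasDerivAt t ((hasDerivAt_const t X).prodMk (hasDerivAt_id t))

namespace HasPartials

variable {U UX Ut W WX Wt : ℝ × ℝ → ℝ}

lemma comp_swap (hU : HasPartials U UX Ut) :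
    HasPartials (U ∘ Prod.swap) (Ut ∘ Prod.swap) (UX ∘ Prod.swap) := by
  have hs : MapsTo Prod.swap closedQuadrant closedQuadrant := fun p hp => ⟨hp.2, hp.1⟩
  exact ⟨hU.cont.comp continuous_swap.continuousOn hs,
    hU.contT.comp continuous_swap.continuousOn hs,
    hU.contX.comp continuous_swap.continuousOn hs,
    fun X t hX ht => hU.derivT t X ht hX, fun X t hX ht => hU.derivX t X ht hX⟩

lemma mul (hU : HasPartials U UX Ut) (hW : HasPartials W WX Wt) :
    HasPartials (fun p => U p * W p) (fun p => UX p * W p + U p * WX p)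
      (fun p => Ut p * W p + U p * Wt p) :=
  ⟨hU.cont.mul hW.cont, (hU.contX.mul hW.cont).add (hU.cont.mul hW.contX),
    (hU.contT.mul hW.cont).add (hU.cont.mul hW.contT),
    fun X t hX ht => (hU.derivX X t hX ht).mul (hW.derivX X t hX ht),
    fun X t hX ht => (hU.derivT X t hX ht).mul (hW.derivT X t hX ht)⟩

lemma partialT_eq_zero (hU : HasPartials U UX Ut) {K : Set (ℝ × ℝ)} (hK : IsCompact K)
    (hUK : ∀ p ∉ K, U p = 0) {X t : ℝ} (hX : 0 < X) (ht : 0 < t) (hp : (X, t) ∉ K) :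
    Ut (X, t) = 0 := by
  refine (hU.derivT X t hX ht).unique ((hasDerivAt_const t (0 : ℝ)).congr_of_eventuallyEq ?_)
  have : Continuous fun τ : ℝ => (X, τ) := by fun_prop
  filter_upwards [this.continuousAt.preimage_mem_nhds (hK.isClosed.isOpen_compl.mem_nhds hp)]
    with τ hτ using hUK _ hτ

end HasPartials

/-- The function `(X, t) ↦ a t` has partial derivatives `0` and `a'`. -/
lemma ContDiffOn.hasPartials_snd {a : ℝ → ℝ} (ha : ContDiffOn ℝ 1 a (Ici 0)) :
    HasPartials (fun p => a p.2) (fun _ => 0) (fun p => derivWithin a (Ici 0) p.2) := by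
  have hs : MapsTo (Prod.snd : ℝ × ℝ → ℝ) closedQuadrant (Ici 0) := fun p hp => hp.2
  refine ⟨ha.continuousOn.comp continuous_snd.continuousOn hs, continuousOn_const,
    (ha.continuousOn_derivWithin (uniqueDiffOn_Ici 0) le_rfl).comp continuous_snd.continuousOn hs,
    fun X t _ _ => hasDerivAt_const X (a t), fun X t _ ht => ?_⟩
  exact (ha.differentiableOn one_ne_zero t ht.le).hasDerivWithinAt.hasDerivAt (Ici_mem_nhds ht)

/-- A function continuous on a closed set is integrable on any measurable subset outside a compact
part of which it vanishes. -/
lemma ContinuousOn.integrableOn_of_eq_zero_off_isCompact {E : Type*} [TopologicalSpace E]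
    [T2Space E] [MeasurableSpace E] [BorelSpace E] {μ : Measure E} [IsFiniteMeasureOnCompacts μ]
    {F : E → ℝ} {S T K : Set E} (hF : ContinuousOn F S) (hS : IsClosed S) (hTS : T ⊆ S)
    (hT : MeasurableSet T) (hK : IsCompact K) (h0 : ∀ x ∈ T, x ∉ K → F x = 0) :
    IntegrableOn F T μ := by
  have h1 : IntegrableOn F (K ∩ S) μ :=
    (hF.mono inter_subset_right).integrableOn_compact (hK.inter_right hS)
  exact h1.of_forall_sdiff_eq_zero hT fun x hx => h0 x hx.1 fun hxK => hx.2 ⟨hxK, hTS hx.1⟩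

lemma ContinuousOn.integrableOn_openQuadrant {F : ℝ × ℝ → ℝ} (hF : ContinuousOn F closedQuadrant)
    {K : Set (ℝ × ℝ)} (hK : IsCompact K) (h0 : ∀ p ∈ openQuadrant, p ∉ K → F p = 0) :
    IntegrableOn F openQuadrant :=
  hF.integrableOn_of_eq_zero_off_isCompact (isClosed_Ici.prod isClosed_Ici)
    openQuadrant_subset_closedQuadrant (measurableSet_Ioi.prod measurableSet_Ioi) hK h0

lemma HasPartials.integrableOn_mul_partialT {U UX Ut W WX Wt : ℝ × ℝ → ℝ}
    (hU : HasPartials U UX Ut) (hW : HasPartials W WX Wt) {K : Set (ℝ × ℝ)} (hK : IsCompact K)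
    (hWK : ∀ p ∉ K, W p = 0) : IntegrableOn (fun p => U p * Wt p) openQuadrant :=
  (hU.cont.mul hW.contT).integrableOn_openQuadrant hK fun p hp hpK => by
    change U p * Wt p = 0
    rw [show Wt p = 0 from hW.partialT_eq_zero hK hWK hp.1 hp.2 hpK, mul_zero]

lemma HasPartials.integrableOn_mul {W WX Wt F : ℝ × ℝ → ℝ} (hW : HasPartials W WX Wt)
    (hF : ContinuousOn F closedQuadrant) {K : Set (ℝ × ℝ)} (hK : IsCompact K)
    (hWK : ∀ p ∉ K, W p = 0) : IntegrableOn (fun p => F p * W p) openQuadrant :=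
  (hF.mul hW.cont).integrableOn_openQuadrant hK fun p _ hpK => by
    change F p * W p = 0
    rw [hWK p hpK, mul_zero]

/-- Integration by parts in the second variable. -/
lemma HasPartials.integral_mul_partialT {U UX Ut W WX Wt : ℝ × ℝ → ℝ} (hU : HasPartials U UX Ut)
    (hW : HasPartials W WX Wt) {K : Set (ℝ × ℝ)} (hK : IsCompact K) (hWK : ∀ p ∉ K, W p = 0) :
    ∫ p in openQuadrant, U p * Wt p =
      -(∫ X in Ioi (0 : ℝ), U (X, 0) * W (X, 0)) - ∫ p in openQuadrant, Ut p * W p := by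
  have hUW := hU.mul hW
  have hUWK : ∀ p ∉ K, U p * W p = 0 := fun p hp => by rw [hWK p hp, mul_zero]
  have i1 := hU.integrableOn_mul_partialT hW hK hWK
  have i2 := hW.integrableOn_mul hU.contT hK hWK
  have key : ∫ p in openQuadrant, (Ut p * W p + U p * Wt p) =
      -(∫ X in Ioi (0 : ℝ), U (X, 0) * W (X, 0)) := by
    rw [Measure.volume_eq_prod, setIntegral_prod (fun p => Ut p * W p + U p * Wt p) (i2.add i1),
      ← integral_neg]
    refine setIntegral_congr_fun measurableSet_Ioi fun X hX => ?_
    have hm : MapsTo (fun t : ℝ => (X, t)) (Ici 0) closedQuadrant :=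
      fun t ht => ⟨(mem_Ioi.1 hX).le, ht⟩
    have hc : Continuous fun t : ℝ => (X, t) := by fun_prop
    have hK2 : IsCompact (Prod.snd '' K) := hK.image continuous_snd
    have hout : ∀ t ∉ Prod.snd '' K, (X, t) ∉ K := fun t ht h => ht ⟨_, h, rfl⟩
    have := integral_Ioi_of_hasDerivAt_of_tendsto (a := 0) (m := 0)
      (f := fun t => U (X, t) * W (X, t))
      (f' := fun t => Ut (X, t) * W (X, t) + U (X, t) * Wt (X, t))
      ((hUW.cont.comp hc.continuousOn hm) 0 self_mem_Ici)
      (fun t ht => hUW.derivT X t hX ht)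
      ((hUW.contT.comp hc.continuousOn hm).integrableOn_of_eq_zero_off_isCompact isClosed_Ici
        Ioi_subset_Ici_self measurableSet_Ioi hK2
        fun t ht htK => hUW.partialT_eq_zero hK hUWK hX ht (hout t htK))
      (by
        refine tendsto_const_nhds.congr' ?_
        have := hK2.compl_mem_cocompact
        filter_upwards [atTop_le_cocompact this] with t ht
        exact (hUWK _ (hout t ht)).symm)
    simpa using this
  rw [integral_add i2 i1] at key
  linarith

lemma HasPartials.iterated_integral_mul_deriv {U UX Ut W WX Wt : ℝ × ℝ → ℝ}
    (hU : HasPartials U UX Ut) (hW : HasPartials W WX Wt) {K : Set (ℝ × ℝ)} (hK : IsCompact K)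
    (hWK : ∀ p ∉ K, W p = 0) :
    ∫ X in Ioi (0 : ℝ), ∫ t in Ioi (0 : ℝ), U (X, t) * deriv (fun τ => W (X, τ)) t =
      -(∫ X in Ioi (0 : ℝ), U (X, 0) * W (X, 0)) - ∫ p in openQuadrant, Ut p * W p := by
  rw [← hU.integral_mul_partialT hW hK hWK, Measure.volume_eq_prod, setIntegral_prod]
  · refine setIntegral_congr_fun measurableSet_Ioi fun X hX => ?_
    refine setIntegral_congr_fun measurableSet_Ioi fun t ht => ?_
    simp only [(hW.derivT X t hX ht).deriv]
  · exact hU.integrableOn_mul_partialT hW hK hWK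

/-- The weak form of the operator `A_t - B_X` on the quadrant. -/
lemma HasPartials.weak_identity {A AX At B BX Bt W WX Wt : ℝ × ℝ → ℝ}
    (hA : HasPartials A AX At) (hB : HasPartials B BX Bt) (hW : HasPartials W WX Wt)
    {K : Set (ℝ × ℝ)} (hK : IsCompact K) (hWK : ∀ p ∉ K, W p = 0) :
    -(∫ X in Ioi (0 : ℝ), ∫ t in Ioi (0 : ℝ), A (X, t) * deriv (fun τ => W (X, τ)) t)
      + ∫ t in Ioi (0 : ℝ), ∫ X in Ioi (0 : ℝ), B (X, t) * deriv (fun Y => W (Y, t)) X =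
    (∫ X in Ioi (0 : ℝ), A (X, 0) * W (X, 0)) - (∫ t in Ioi (0 : ℝ), B (0, t) * W (0, t))
      + ∫ p in openQuadrant, (At p - BX p) * W p := by
  have h1 := hA.iterated_integral_mul_deriv hW hK hWK
  have h2 := hB.comp_swap.iterated_integral_mul_deriv hW.comp_swap (hK.image continuous_swap)
    (fun p hp => hWK _ fun h => hp ⟨_, h, Prod.swap_swap p⟩)
  have h3 : ∫ p in openQuadrant, (BX ∘ Prod.swap) p * (W ∘ Prod.swap) p =
      ∫ p in openQuadrant, BX p * W p :=
    setIntegral_prod_swap (Ioi (0 : ℝ)) (Ioi (0 : ℝ)) (fun p : ℝ × ℝ => BX p * W p)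
  have h4 : ∫ p in openQuadrant, (At p - BX p) * W p =
      (∫ p in openQuadrant, At p * W p) - ∫ p in openQuadrant, BX p * W p := by
    rw [← integral_sub (hW.integrableOn_mul hA.contT hK hWK)
      (hW.integrableOn_mul hB.contX hK hWK)]
    simp only [sub_mul]
  rw [h3] at h2
  simp only [comp_apply, Prod.swap_prod_mk] at h2
  rw [h1, h2, h4]
  ring

/-- The fundamental lemma of the calculus of variations on an open set. -/
lemma ContinuousOn.eq_zero_of_setIntegral_mul_eq_zero {E : Type*} [NormedAddCommGroup E]
    [NormedSpace ℝ E] [FiniteDimensional ℝ E] [MeasurableSpace E] [BorelSpace E] {μ : Measure E}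
    [μ.IsOpenPosMeasure] [IsLocallyFiniteMeasure μ] {h : E → ℝ} {U : Set E}
    (hh : ContinuousOn h U) (hU : IsOpen U)
    (H : ∀ w : E → ℝ, ContDiff ℝ 1 w → HasCompactSupport w → tsupport w ⊆ U →
      ∫ x in U, h x * w x ∂μ = 0) : ∀ x ∈ U, h x = 0 := by
  have hae : ∀ᵐ x ∂μ, x ∈ U → h x = 0 := by
    refine hU.ae_eq_zero_of_integral_contDiff_smul_eq_zero
      (hh.locallyIntegrableOn hU.measurableSet) fun w hw hwc hwU => ?_
    rw [← H w (hw.of_le (by exact_mod_cast le_top)) hwc hwU,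
      setIntegral_eq_integral_of_forall_compl_eq_zero]
    · simp only [smul_eq_mul, mul_comm]
    · intro x hx
      rw [image_eq_zero_of_notMem_tsupport fun h => hx (hwU h), mul_zero]
  exact Measure.eqOn_open_of_ae_eq (g := fun _ => 0)
    ((ae_restrict_iff' hU.measurableSet).2 hae) hU hh continuousOn_const

lemma eqOn_Ici_of_setIntegral_mul_eq {h k : ℝ → ℝ} (hh : ContinuousOn h (Ici 0))
    (hk : ContinuousOn k (Ici 0))
    (H : ∀ w : ℝ → ℝ, ContDiff ℝ 1 w → HasCompactSupport w → tsupport w ⊆ Ioi 0 →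
      ∫ x in Ioi (0 : ℝ), h x * w x = ∫ x in Ioi (0 : ℝ), k x * w x) :
    EqOn h k (Ici 0) := by
  have hInt : ∀ F w : ℝ → ℝ, ContinuousOn F (Ici 0) → Continuous w → HasCompactSupport w →
      IntegrableOn (fun x => F x * w x) (Ioi 0) := fun F w hF hw hwc =>
    (hF.mul hw.continuousOn).integrableOn_of_eq_zero_off_isCompact isClosed_Ici
      Ioi_subset_Ici_self measurableSet_Ioi hwc fun x _ hx => by
        change F x * w x = 0
        rw [image_eq_zero_of_notMem_tsupport hx, mul_zero]
  have h0 : ∀ x ∈ Ioi (0 : ℝ), h x - k x = 0 := by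
    refine ContinuousOn.eq_zero_of_setIntegral_mul_eq_zero (h := fun x => h x - k x)
      (μ := volume) ((hh.sub hk).mono Ioi_subset_Ici_self) isOpen_Ioi fun w hw hwc hwU => ?_
    simp only [sub_mul]
    rw [integral_sub (hInt h w hh hw.continuous hwc) (hInt k w hk hw.continuous hwc),
      H w hw hwc hwU, sub_self]
  exact EqOn.of_subset_closure (fun x hx => sub_eq_zero.1 (h0 x hx)) hh hk Ioi_subset_Ici_self
    (closure_Ioi (0 : ℝ)).ge

/-- A `C¹` compactly supported cutoff function on the line equal to `1` at the origin. -/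
lemma exists_contDiff_hasCompactSupport_eq_one :
    ∃ β : ℝ → ℝ, ContDiff ℝ 1 β ∧ HasCompactSupport β ∧ β 0 = 1 := by
  obtain ⟨β, -, hc, hd, -, h1⟩ :=
    exists_contDiff_tsupport_subset (n := 1) (Filter.univ_mem : univ ∈ nhds (0 : ℝ))
  exact ⟨β, hd, hc, h1⟩

lemma HasCompactSupport.mul_prod {α β : ℝ → ℝ} (hα : HasCompactSupport α)
    (hβ : HasCompactSupport β) : HasCompactSupport fun p : ℝ × ℝ => α p.1 * β p.2 := by
  refine HasCompactSupport.intro (hα.isCompact.prod hβ.isCompact) fun p hp => ?_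
  by_cases h : p.1 ∈ tsupport α
  · rw [image_eq_zero_of_notMem_tsupport (fun h' => hp ⟨h, h'⟩ : p.2 ∉ tsupport β), mul_zero]
  · rw [image_eq_zero_of_notMem_tsupport h, zero_mul]

lemma ContDiff.mul_prod {α β : ℝ → ℝ} (hα : ContDiff ℝ 1 α) (hβ : ContDiff ℝ 1 β) :
    ContDiff ℝ 1 fun p : ℝ × ℝ => α p.1 * β p.2 :=
  (hα.comp contDiff_fst).mul (hβ.comp contDiff_snd)

/-- For `P` C¹, `f, g, a, c` C¹ on `[0,∞)`, and `V, Γ` C¹ on `[0,∞)²`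
with `P∘Γ` C¹ on `[0,∞)²`, the pair `(V,Γ)` is a classical solution of the p-system
`V_t − (P(Γ))_X = 0`, `Γ_t − V_X = 0` on `(0,∞)²` with `V(X,0)=f(X)`, `Γ(X,0)=g(X)`,
`P(Γ(0,t)) + a(t)V(0,t) = c(t)`, iff the weak formulations (ws3) (for all C¹
compactly supported `ψ` with `ψ(0,·)=0`) and (ws4) (for all C¹ compactly
supported `φ`) hold. -/
theorem stmt_0 (P f g a c : ℝ → ℝ) (V Γ : ℝ → ℝ → ℝ)
    (hP : ContDiff ℝ 1 P)
    (hf : ContDiffOn ℝ 1 f (Set.Ici 0)) (hg : ContDiffOn ℝ 1 g (Set.Ici 0))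
    (ha : ContDiffOn ℝ 1 a (Set.Ici 0)) (hc : ContDiffOn ℝ 1 c (Set.Ici 0))
    (hV : ContDiffOn ℝ 1 (fun p : ℝ × ℝ => V p.1 p.2) (Set.Ici 0 ×ˢ Set.Ici 0))
    (hΓ : ContDiffOn ℝ 1 (fun p : ℝ × ℝ => Γ p.1 p.2) (Set.Ici 0 ×ˢ Set.Ici 0))
    (hPΓ : ContDiffOn ℝ 1 (fun p : ℝ × ℝ => P (Γ p.1 p.2)) (Set.Ici 0 ×ˢ Set.Ici 0)) :
    ((∀ X t : ℝ, 0 < X → 0 < t →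
        deriv (fun τ => V X τ) t - deriv (fun Y => P (Γ Y t)) X = 0 ∧
        deriv (fun τ => Γ X τ) t - deriv (fun Y => V Y t) X = 0) ∧
      (∀ X : ℝ, 0 ≤ X → V X 0 = f X ∧ Γ X 0 = g X) ∧
      (∀ t : ℝ, 0 ≤ t → P (Γ 0 t) + a t * V 0 t = c t))
    ↔
    ((∀ ψ : ℝ → ℝ → ℝ, ContDiff ℝ 1 (fun p : ℝ × ℝ => ψ p.1 p.2) →
        HasCompactSupport (fun p : ℝ × ℝ => ψ p.1 p.2) →
        (∀ t : ℝ, ψ 0 t = 0) →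
        -(∫ X in Set.Ioi (0 : ℝ), g X * ψ X 0)
          - (∫ X in Set.Ioi (0 : ℝ), ∫ t in Set.Ioi (0 : ℝ),
              Γ X t * deriv (fun τ => ψ X τ) t)
          + (∫ t in Set.Ioi (0 : ℝ), ∫ X in Set.Ioi (0 : ℝ),
              V X t * deriv (fun Y => ψ Y t) X) = 0) ∧
      (∀ φ : ℝ → ℝ → ℝ, ContDiff ℝ 1 (fun p : ℝ × ℝ => φ p.1 p.2) →
        HasCompactSupport (fun p : ℝ × ℝ => φ p.1 p.2) →
        -(∫ X in Set.Ioi (0 : ℝ), f X * φ X 0)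
          - (∫ X in Set.Ioi (0 : ℝ), ∫ t in Set.Ioi (0 : ℝ),
              V X t * deriv (fun τ => φ X τ) t)
          + (∫ t in Set.Ioi (0 : ℝ), c t * φ 0 t)
          + (∫ t in Set.Ioi (0 : ℝ), ∫ X in Set.Ioi (0 : ℝ),
              P (Γ X t) * deriv (fun Y => φ Y t) X)
          - (∫ X in Set.Ioi (0 : ℝ), g X * a 0 * φ X 0)
          - (∫ X in Set.Ioi (0 : ℝ), ∫ t in Set.Ioi (0 : ℝ),
              deriv (fun τ => a τ * φ X τ) t * Γ X t)
          + (∫ t in Set.Ioi (0 : ℝ), ∫ X in Set.Ioi (0 : ℝ),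
              a t * deriv (fun Y => φ Y t) X * V X t) = 0)) := by
  obtain ⟨VX, Vt, dV⟩ := hV.exists_hasPartials
  obtain ⟨ΓX, Γt, dΓ⟩ := hΓ.exists_hasPartials
  obtain ⟨QX, Qt, dQ⟩ := hPΓ.exists_hasPartials
  have da := ha.hasPartials_snd
  have hX0 : MapsTo (fun X : ℝ => (X, (0 : ℝ))) (Ici 0) closedQuadrant :=
    fun X hX => ⟨hX, self_mem_Ici⟩
  have h0t : MapsTo (fun t : ℝ => ((0 : ℝ), t)) (Ici 0) closedQuadrant :=
    fun t ht => ⟨self_mem_Ici, ht⟩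
  have cX0 : Continuous fun X : ℝ => (X, (0 : ℝ)) := by fun_prop
  have c0t : Continuous fun t : ℝ => ((0 : ℝ), t) := by fun_prop
  have cV0 : ContinuousOn (fun X => V X 0) (Ici 0) := dV.cont.comp cX0.continuousOn hX0
  have cΓ0 : ContinuousOn (fun X => Γ X 0) (Ici 0) := dΓ.cont.comp cX0.continuousOn hX0
  have cVb : ContinuousOn (fun t => V 0 t) (Ici 0) := dV.cont.comp c0t.continuousOn h0t
  have cQb : ContinuousOn (fun t => P (Γ 0 t)) (Ici 0) := dQ.cont.comp c0t.continuousOn h0t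
  have cE1 : ContinuousOn (fun p => Γt p - VX p) closedQuadrant := dΓ.contT.sub dV.contX
  have cE2 : ContinuousOn (fun p => Vt p - QX p) closedQuadrant := dV.contT.sub dQ.contX
  have ho : IsOpen openQuadrant := isOpen_Ioi.prod isOpen_Ioi
  have pde : (∀ X t : ℝ, 0 < X → 0 < t →
        deriv (fun τ => V X τ) t - deriv (fun Y => P (Γ Y t)) X = 0 ∧
        deriv (fun τ => Γ X τ) t - deriv (fun Y => V Y t) X = 0) ↔
      (∀ p ∈ openQuadrant, Vt p - QX p = 0) ∧ (∀ p ∈ openQuadrant, Γt p - VX p = 0) := by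
    have e : ∀ X t : ℝ, 0 < X → 0 < t →
        deriv (fun τ => V X τ) t = Vt (X, t) ∧ deriv (fun Y => P (Γ Y t)) X = QX (X, t) ∧
        deriv (fun τ => Γ X τ) t = Γt (X, t) ∧ deriv (fun Y => V Y t) X = VX (X, t) :=
      fun X t hX ht => ⟨(dV.derivT X t hX ht).deriv, (dQ.derivX X t hX ht).deriv,
        (dΓ.derivT X t hX ht).deriv, (dV.derivX X t hX ht).deriv⟩
    constructor
    · intro h
      refine ⟨fun p hp => ?_, fun p hp => ?_⟩ <;>
      · obtain ⟨e1, e2, e3, e4⟩ := e p.1 p.2 hp.1 hp.2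
        have := h p.1 p.2 hp.1 hp.2
        rw [e1, e2, e3, e4] at this
        first | exact this.1 | exact this.2
    · rintro ⟨h1, h2⟩ X t hX ht
      obtain ⟨e1, e2, e3, e4⟩ := e X t hX ht
      rw [e1, e2, e3, e4]
      exact ⟨h1 (X, t) ⟨hX, ht⟩, h2 (X, t) ⟨hX, ht⟩⟩
  have weak1 : ∀ ψ : ℝ → ℝ → ℝ, ContDiff ℝ 1 (fun p : ℝ × ℝ => ψ p.1 p.2) →
      HasCompactSupport (fun p : ℝ × ℝ => ψ p.1 p.2) → (∀ t : ℝ, ψ 0 t = 0) →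
      -(∫ X in Set.Ioi (0 : ℝ), g X * ψ X 0)
          - (∫ X in Set.Ioi (0 : ℝ), ∫ t in Set.Ioi (0 : ℝ),
              Γ X t * deriv (fun τ => ψ X τ) t)
          + (∫ t in Set.Ioi (0 : ℝ), ∫ X in Set.Ioi (0 : ℝ),
              V X t * deriv (fun Y => ψ Y t) X) =
        ((∫ X in Ioi (0 : ℝ), Γ X 0 * ψ X 0) - ∫ X in Ioi (0 : ℝ), g X * ψ X 0)
          + ∫ p in openQuadrant, (Γt p - VX p) * ψ p.1 p.2 := by
    intro ψ hψ hψc hψ0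
    obtain ⟨ψX, ψt, dψ⟩ := hψ.contDiffOn.exists_hasPartials
    have := dΓ.weak_identity dV dψ hψc fun p hp =>
      image_eq_zero_of_notMem_tsupport (f := fun p : ℝ × ℝ => ψ p.1 p.2) hp
    simp only [hψ0, mul_zero, integral_zero] at this
    linarith
  have weak2 : ∀ φ : ℝ → ℝ → ℝ, ContDiff ℝ 1 (fun p : ℝ × ℝ => φ p.1 p.2) →
        HasCompactSupport (fun p : ℝ × ℝ => φ p.1 p.2) →
        -(∫ X in Set.Ioi (0 : ℝ), f X * φ X 0)
          - (∫ X in Set.Ioi (0 : ℝ), ∫ t in Set.Ioi (0 : ℝ),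
              V X t * deriv (fun τ => φ X τ) t)
          + (∫ t in Set.Ioi (0 : ℝ), c t * φ 0 t)
          + (∫ t in Set.Ioi (0 : ℝ), ∫ X in Set.Ioi (0 : ℝ),
              P (Γ X t) * deriv (fun Y => φ Y t) X)
          - (∫ X in Set.Ioi (0 : ℝ), g X * a 0 * φ X 0)
          - (∫ X in Set.Ioi (0 : ℝ), ∫ t in Set.Ioi (0 : ℝ),
              deriv (fun τ => a τ * φ X τ) t * Γ X t)
          + (∫ t in Set.Ioi (0 : ℝ), ∫ X in Set.Ioi (0 : ℝ),
              a t * deriv (fun Y => φ Y t) X * V X t) =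
        ((∫ X in Ioi (0 : ℝ), V X 0 * φ X 0) - ∫ X in Ioi (0 : ℝ), f X * φ X 0)
          + ((∫ X in Ioi (0 : ℝ), Γ X 0 * a 0 * φ X 0) - ∫ X in Ioi (0 : ℝ), g X * a 0 * φ X 0)
          + ((∫ t in Ioi (0 : ℝ), c t * φ 0 t)
            - ∫ t in Ioi (0 : ℝ), (P (Γ 0 t) + a t * V 0 t) * φ 0 t)
          + (∫ p in openQuadrant, (Vt p - QX p) * φ p.1 p.2)
          + ∫ p in openQuadrant, (Γt p - VX p) * (a p.2 * φ p.1 p.2) := by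
    intro φ hφ hφc
    obtain ⟨φX, φt, dφ⟩ := hφ.contDiffOn.exists_hasPartials
    have hφK : ∀ p ∉ tsupport (fun p : ℝ × ℝ => φ p.1 p.2), φ p.1 p.2 = 0 :=
      fun p hp => image_eq_zero_of_notMem_tsupport (f := fun p : ℝ × ℝ => φ p.1 p.2) hp
    have h1 := dV.weak_identity dQ dφ hφc hφK
    have h2 := dΓ.weak_identity dV (da.mul dφ) hφc fun p hp => by rw [hφK p hp, mul_zero]
    have hφb : ∀ t ∉ Prod.snd '' tsupport (fun p : ℝ × ℝ => φ p.1 p.2), φ 0 t = 0 :=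
      fun t ht => hφK (0, t) fun h => ht ⟨_, h, rfl⟩
    have hInt : ∀ F : ℝ → ℝ, ContinuousOn F (Ici 0) →
        IntegrableOn (fun t => F t * φ 0 t) (Ioi 0) := fun F hF =>
      (hF.mul (hφ.continuous.comp c0t).continuousOn).integrableOn_of_eq_zero_off_isCompact
        isClosed_Ici Ioi_subset_Ici_self measurableSet_Ioi (hφc.isCompact.image continuous_snd)
        fun t _ ht => by
          change F t * φ 0 t = 0
          rw [hφb t ht, mul_zero]
    have h3 : ∫ t in Ioi (0 : ℝ), (P (Γ 0 t) + a t * V 0 t) * φ 0 t =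
        (∫ t in Ioi (0 : ℝ), P (Γ 0 t) * φ 0 t)
          + ∫ t in Ioi (0 : ℝ), (a t * V 0 t) * φ 0 t := by
      rw [← integral_add (hInt _ cQb)
        (hInt (fun t => a t * V 0 t) (ha.continuousOn.mul cVb))]
      simp only [add_mul]
    have h4 : ∀ t : ℝ, V 0 t * (a t * φ 0 t) = a t * V 0 t * φ 0 t := fun t => by ring
    have h5 : ∀ X t : ℝ, V X t * (a t * deriv (fun Y => φ Y t) X) =
      a t * deriv (fun Y => φ Y t) X * V X t := fun X t => by ring
    have h6 : ∀ X t : ℝ, Γ X t * deriv (fun τ => a τ * φ X τ) t =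
      deriv (fun τ => a τ * φ X τ) t * Γ X t := fun X t => mul_comm _ _
    have h7 : ∀ X : ℝ, Γ X 0 * (a 0 * φ X 0) = Γ X 0 * a 0 * φ X 0 := fun X => by ring
    simp only [deriv_const_mul_field, h4, h5, h6, h7] at h2
    linarith
  rw [pde]
  constructor
  · rintro ⟨⟨hE2, hE1⟩, hinit, hbd⟩
    have z1 : ∀ w : ℝ × ℝ → ℝ, ∫ p in openQuadrant, (Γt p - VX p) * w p = 0 := fun w =>
      setIntegral_eq_zero_of_forall_eq_zero fun p hp => by rw [hE1 p hp, zero_mul]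
    have z2 : ∀ w : ℝ × ℝ → ℝ, ∫ p in openQuadrant, (Vt p - QX p) * w p = 0 := fun w =>
      setIntegral_eq_zero_of_forall_eq_zero fun p hp => by rw [hE2 p hp, zero_mul]
    have hcongr : ∀ u v : ℝ → ℝ, (∀ x, 0 ≤ x → u x = v x) →
        ∫ x in Ioi (0 : ℝ), u x = ∫ x in Ioi (0 : ℝ), v x := fun u v h =>
      setIntegral_congr_fun measurableSet_Ioi fun x hx => h x (mem_Ioi.1 hx).le
    constructor
    · intro ψ hψ hψc hψ0
      rw [weak1 ψ hψ hψc hψ0, z1,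
        hcongr _ (fun X => g X * ψ X 0) fun X hX => by rw [(hinit X hX).2]]
      ring
    · intro φ hφ hφc
      rw [weak2 φ hφ hφc, z1, z2,
        hcongr (fun X => V X 0 * φ X 0) (fun X => f X * φ X 0) fun X hX => by rw [(hinit X hX).1],
        hcongr (fun X => Γ X 0 * a 0 * φ X 0) (fun X => g X * a 0 * φ X 0)
          fun X hX => by rw [(hinit X hX).2],
        hcongr (fun t => (P (Γ 0 t) + a t * V 0 t) * φ 0 t) (fun t => c t * φ 0 t)
          fun t ht => by rw [hbd t ht]]
      ring
  · rintro ⟨H1, H2⟩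
    obtain ⟨β, hβ, hβc, hβ0⟩ := exists_contDiff_hasCompactSupport_eq_one
    have vanish : ∀ w : ℝ × ℝ → ℝ, tsupport w ⊆ openQuadrant → ∀ X t : ℝ, X = 0 ∨ t = 0 →
        w (X, t) = 0 := fun w hw X t h =>
      image_eq_zero_of_notMem_tsupport fun hp => h.elim (hw hp).1.ne' (hw hp).2.ne'
    have vanish' : ∀ w : ℝ → ℝ, tsupport w ⊆ Ioi 0 → w 0 = 0 := fun w hw =>
      image_eq_zero_of_notMem_tsupport fun hp => lt_irrefl (0 : ℝ) (hw hp)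
    have hE1 : ∀ p ∈ openQuadrant, Γt p - VX p = 0 := by
      refine (cE1.mono openQuadrant_subset_closedQuadrant).eq_zero_of_setIntegral_mul_eq_zero
        (μ := volume) ho fun w hw hwc hwU => ?_
      have h0 := vanish w hwU
      have := weak1 (fun X t => w (X, t)) hw hwc fun t => h0 0 t (.inl rfl)
      rw [H1 (fun X t => w (X, t)) hw hwc fun t => h0 0 t (.inl rfl)] at this
      simpa [h0 _ 0 (.inr rfl)] using this.symm
    have z1 : ∀ w : ℝ × ℝ → ℝ, ∫ p in openQuadrant, (Γt p - VX p) * w p = 0 := fun w =>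
      setIntegral_eq_zero_of_forall_eq_zero fun p hp => by rw [hE1 p hp, zero_mul]
    have hΓg : EqOn (fun X => Γ X 0) g (Ici 0) := by
      refine eqOn_Ici_of_setIntegral_mul_eq cΓ0 hg.continuousOn fun w hw hwc hwU => ?_
      have hw0 : ∀ t, w 0 * β t = 0 := fun t => by rw [vanish' w hwU, zero_mul]
      have := weak1 (fun X t => w X * β t) (hw.mul_prod hβ) (hwc.mul_prod hβc) hw0
      rw [H1 (fun X t => w X * β t) (hw.mul_prod hβ) (hwc.mul_prod hβc) hw0, z1] at this
      simp only [hβ0, mul_one] at this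
      linarith
    have hΓg' : ∀ φ : ℝ → ℝ → ℝ, ∫ X in Ioi (0 : ℝ), Γ X 0 * a 0 * φ X 0 =
        ∫ X in Ioi (0 : ℝ), g X * a 0 * φ X 0 := fun φ =>
      setIntegral_congr_fun measurableSet_Ioi fun X hX => by
        simp only [show Γ X 0 = g X from hΓg (mem_Ioi.1 hX).le]
    have hE2 : ∀ p ∈ openQuadrant, Vt p - QX p = 0 := by
      refine (cE2.mono openQuadrant_subset_closedQuadrant).eq_zero_of_setIntegral_mul_eq_zero
        (μ := volume) ho fun w hw hwc hwU => ?_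
      have h0 := vanish w hwU
      have := weak2 (fun X t => w (X, t)) hw hwc
      rw [H2 (fun X t => w (X, t)) hw hwc, z1] at this
      simpa [h0 _ 0 (.inr rfl), h0 0 _ (.inl rfl)] using this.symm
    have z2 : ∀ w : ℝ × ℝ → ℝ, ∫ p in openQuadrant, (Vt p - QX p) * w p = 0 := fun w =>
      setIntegral_eq_zero_of_forall_eq_zero fun p hp => by rw [hE2 p hp, zero_mul]
    have hVf : EqOn (fun X => V X 0) f (Ici 0) := by
      refine eqOn_Ici_of_setIntegral_mul_eq cV0 hf.continuousOn fun w hw hwc hwU => ?_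
      have := weak2 (fun X t => w X * β t) (hw.mul_prod hβ) (hwc.mul_prod hβc)
      rw [H2 (fun X t => w X * β t) (hw.mul_prod hβ) (hwc.mul_prod hβc), z1, z2,
        hΓg' fun X t => w X * β t] at this
      simp only [hβ0, mul_one, vanish' w hwU, zero_mul, mul_zero, integral_zero] at this
      linarith
    have hbd : EqOn (fun t => P (Γ 0 t) + a t * V 0 t) c (Ici 0) := by
      refine eqOn_Ici_of_setIntegral_mul_eq (cQb.add (ha.continuousOn.mul cVb)) hc.continuousOn
        fun w hw hwc hwU => ?_
      have := weak2 (fun X t => β X * w t) (hβ.mul_prod hw) (hβc.mul_prod hwc)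
      rw [H2 (fun X t => β X * w t) (hβ.mul_prod hw) (hβc.mul_prod hwc), z1, z2,
        hΓg' fun X t => β X * w t] at this
      simp only [hβ0, one_mul, vanish' w hwU, mul_zero, integral_zero] at this
      linarith
    exact ⟨⟨hE2, hE1⟩, fun X hX => ⟨hVf hX, hΓg hX⟩, fun t ht => hbd ht⟩
end

section
/- Let P be a real function with P(0)=0, let V₀>0, Γ_l∈(−1,0) satisfy the Rankine–Hugoniot conditions Γ_l·P(Γ_l)=V₀² and σ = −V₀/Γ_l (so σ>0). Define the piecewise constant functions on [0,∞)×[0,∞): V(X,t) = −V₀ if X>σt and V(X,t)=0 if X<σt; Γ(X,t) = 0 if X>σt and Γ(X,t)=Γ_l if X<σt. Then (V,Γ) is a weak solution of the initial–boundary value problem with data V(X,0)=−V₀, Γ(X,0)=0, V(0,t)=0; that is: (i) for every C¹ compactly supported φ:[0,∞)×[0,∞)→ℝ with φ(0,t)=0 for all t, ∫₀^∞∫₀^∞ (V φ_t − P(Γ) φ_X) dt dX + ∫₀^∞ (−V₀)φ(X,0)dX = 0, and (ii) for every C¹ compactly supported ψ:[0,∞)×[0,∞)→ℝ, ∫₀^∞∫₀^∞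 (Γ ψ_t − V ψ_X) dt dX = 0. -/
open Set MeasureTheory Function

/-- The integral over `(0, ∞)` of a compactly supported derivative cut off to `(a, ∞)`. -/
lemma integral_indicator_Ioi_deriv {g : ℝ → ℝ} (hg : ContDiff ℝ 1 g) (hc : HasCompactSupport g)
    {a : ℝ} (ha : 0 ≤ a) :
    ∫ t in Ioi (0 : ℝ), (Ioi a).indicator (deriv g) t = -g a := by
  rw [setIntegral_indicator measurableSet_Ioi, Ioi_inter_Ioi, max_eq_right ha,
    hc.integral_Ioi_deriv_eq hg]

/-- The integral over `(0, ∞)` of a derivative cut off to `(-∞, a]`. -/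
lemma integral_indicator_Iic_deriv {g : ℝ → ℝ} (hg : ContDiff ℝ 1 g) {a : ℝ} (ha : 0 ≤ a) :
    ∫ t in Ioi (0 : ℝ), (Iic a).indicator (deriv g) t = g a - g 0 := by
  rw [setIntegral_indicator measurableSet_Iic, Ioi_inter_Iic,
    ← intervalIntegral.integral_of_le ha, intervalIntegral.integral_deriv_eq_sub]
  · exact fun x _ => hg.differentiable one_ne_zero x
  · exact (hg.continuous_deriv le_rfl).intervalIntegrable _ _

section Slices

variable {φ : ℝ → ℝ → ℝ}

lemma contDiff_slice_right (h : ContDiff ℝ 1 (fun p : ℝ × ℝ => φ p.1 p.2)) (x : ℝ) :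
    ContDiff ℝ 1 (fun t => φ x t) :=
  h.comp (contDiff_const.prodMk contDiff_id)

lemma hasCompactSupport_slice_right
    (hc : HasCompactSupport (fun p : ℝ × ℝ => φ p.1 p.2)) (x : ℝ) :
    HasCompactSupport (fun t => φ x t) :=
  have hl : LeftInverse (Prod.snd : ℝ × ℝ → ℝ) (fun t : ℝ => (x, t)) := fun _ => rfl
  hc.comp_isClosedEmbedding (hl.isClosedEmbedding continuous_snd (by fun_prop))

lemma contDiff_flip (h : ContDiff ℝ 1 (fun p : ℝ × ℝ => φ p.1 p.2)) :
    ContDiff ℝ 1 (fun p : ℝ × ℝ => flip φ p.1 p.2) :=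
  h.comp (contDiff_snd.prodMk contDiff_fst)

lemma hasCompactSupport_flip (hc : HasCompactSupport (fun p : ℝ × ℝ => φ p.1 p.2)) :
    HasCompactSupport (fun p : ℝ × ℝ => flip φ p.1 p.2) :=
  hc.comp_homeomorph (Homeomorph.prodComm ℝ ℝ)

lemma deriv_slice_right (h : ContDiff ℝ 1 (fun p : ℝ × ℝ => φ p.1 p.2)) (p : ℝ × ℝ) :
    deriv (fun t => φ p.1 t) p.2 = fderiv ℝ (fun p : ℝ × ℝ => φ p.1 p.2) p (0, 1) := by
  have h1 : HasFDerivAt (fun p : ℝ × ℝ => φ p.1 p.2)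
      (fderiv ℝ (fun p : ℝ × ℝ => φ p.1 p.2) p) (p.1, p.2) :=
    (h.differentiable one_ne_zero p).hasFDerivAt
  exact (h1.comp_hasDerivAt p.2 ((hasDerivAt_const p.2 p.1).prodMk (hasDerivAt_id p.2))).deriv

/-- The partial derivative in the second variable of a compactly supported `C¹` function, cut off
to a measurable set, is integrable on the quadrant. -/
lemma integrable_indicator_deriv_right (h : ContDiff ℝ 1 (fun p : ℝ × ℝ => φ p.1 p.2))
    (hc : HasCompactSupport (fun p : ℝ × ℝ => φ p.1 p.2)) {S : Set (ℝ × ℝ)}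
    (hS : MeasurableSet S) :
    Integrable (S.indicator fun p : ℝ × ℝ => deriv (fun t => φ p.1 t) p.2)
      ((volume.restrict (Ioi (0 : ℝ))).prod (volume.restrict (Ioi (0 : ℝ)))) := by
  rw [Measure.prod_restrict]
  simp_rw [deriv_slice_right h]
  refine (Integrable.indicator ?_ hS).restrict
  refine Continuous.integrable_of_hasCompactSupport ?_ (hc.fderiv_apply ℝ (0, 1))
  exact (h.continuous_fderiv one_ne_zero).clm_apply continuous_const

lemma integrable_indicator_deriv_left (h : ContDiff ℝ 1 (fun p : ℝ × ℝ => φ p.1 p.2))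
    (hc : HasCompactSupport (fun p : ℝ × ℝ => φ p.1 p.2)) {S : Set (ℝ × ℝ)}
    (hS : MeasurableSet S) :
    Integrable (S.indicator fun p : ℝ × ℝ => deriv (fun x => φ x p.2) p.1)
      ((volume.restrict (Ioi (0 : ℝ))).prod (volume.restrict (Ioi (0 : ℝ)))) :=
  (integrable_indicator_deriv_right (contDiff_flip h) (hasCompactSupport_flip hc)
    (measurable_swap hS)).swap

lemma integrable_along_line (h : ContDiff ℝ 1 (fun p : ℝ × ℝ => φ p.1 p.2))
    (hc : HasCompactSupport (fun p : ℝ × ℝ => φ p.1 p.2)) (m : ℝ) :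
    Integrable (fun x => φ x (x * m)) (volume.restrict (Ioi (0 : ℝ))) := by
  have he : Topology.IsClosedEmbedding (fun x : ℝ => (x, x * m)) := by
    have hl : LeftInverse (Prod.fst : ℝ × ℝ → ℝ) (fun x : ℝ => (x, x * m)) := fun _ => rfl
    exact hl.isClosedEmbedding continuous_fst (by fun_prop)
  exact ((h.continuous.comp he.continuous).integrable_of_hasCompactSupport
    (hc.comp_isClosedEmbedding he)).restrict

variable {σ : ℝ}

lemma measurableSet_ahead (σ : ℝ) : MeasurableSet {p : ℝ × ℝ | σ * p.2 < p.1} :=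
  measurableSet_lt (by fun_prop) (by fun_prop)

lemma measurableSet_behind (σ : ℝ) : MeasurableSet {p : ℝ × ℝ | p.1 < σ * p.2} :=
  measurableSet_lt (by fun_prop) (by fun_prop)

/-- The integral along the line `X = σ t` parametrized by `t`. -/
lemma integral_line_param (hσ : 0 < σ) :
    ∫ t in Ioi (0 : ℝ), φ (σ * t) t = σ⁻¹ * ∫ X in Ioi (0 : ℝ), φ X (X * σ⁻¹) := by
  have := integral_comp_mul_left_Ioi (fun X => φ X (X * σ⁻¹)) 0 hσ
  rw [mul_zero, smul_eq_mul] at this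
  rw [← this]
  congr with t
  congr 1
  field_simp

lemma integral_deriv_right_behind (hσ : 0 < σ)
    (h : ContDiff ℝ 1 (fun p : ℝ × ℝ => φ p.1 p.2))
    (hc : HasCompactSupport (fun p : ℝ × ℝ => φ p.1 p.2)) :
    ∫ X in Ioi (0 : ℝ), ∫ t in Ioi (0 : ℝ), {p : ℝ × ℝ | p.1 < σ * p.2}.indicator
      (fun p : ℝ × ℝ => deriv (fun τ => φ p.1 τ) p.2) (X, t)
      = -∫ X in Ioi (0 : ℝ), φ X (X * σ⁻¹) := by
  rw [← integral_neg]
  refine setIntegral_congr_fun measurableSet_Ioi fun X hX => ?_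
  have hX : 0 < X := hX
  rw [← integral_indicator_Ioi_deriv (contDiff_slice_right h X)
    (hasCompactSupport_slice_right hc X) (by positivity : 0 ≤ X * σ⁻¹)]
  congr with t
  simp only [indicator, mem_ofPred_eq, mem_Ioi, ← div_eq_mul_inv, div_lt_iff₀' hσ]

lemma integral_deriv_right_ahead (hσ : 0 < σ)
    (h : ContDiff ℝ 1 (fun p : ℝ × ℝ => φ p.1 p.2))
    (hc : HasCompactSupport (fun p : ℝ × ℝ => φ p.1 p.2)) :
    ∫ X in Ioi (0 : ℝ), ∫ t in Ioi (0 : ℝ), {p : ℝ × ℝ | σ * p.2 < p.1}.indicator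
      (fun p : ℝ × ℝ => deriv (fun τ => φ p.1 τ) p.2) (X, t)
      = (∫ X in Ioi (0 : ℝ), φ X (X * σ⁻¹)) - ∫ X in Ioi (0 : ℝ), φ X 0 := by
  have h0 := integrable_along_line h hc 0
  simp only [mul_zero] at h0
  rw [← integral_sub (integrable_along_line h hc _) h0]
  refine setIntegral_congr_fun measurableSet_Ioi fun X hX => ?_
  have hX : 0 < X := hX
  rw [← integral_indicator_Iic_deriv (contDiff_slice_right h X)
    (by positivity : 0 ≤ X * σ⁻¹)]
  refine integral_congr_ae (ae_restrict_of_ae ?_)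
  filter_upwards [(measure_eq_zero_iff_ae_notMem).1 (measure_singleton (X * σ⁻¹))] with t ht
  have : σ * t < X ↔ t ≤ X * σ⁻¹ := by
    rw [← div_eq_mul_inv, mem_singleton_iff] at *
    rw [mul_comm, ← lt_div_iff₀ hσ]
    exact ⟨le_of_lt, fun h => lt_of_le_of_ne h ht⟩
  simp only [indicator, mem_ofPred_eq, mem_Iic, this]

lemma integral_deriv_left_ahead (hσ : 0 < σ)
    (h : ContDiff ℝ 1 (fun p : ℝ × ℝ => φ p.1 p.2))
    (hc : HasCompactSupport (fun p : ℝ × ℝ => φ p.1 p.2)) :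
    ∫ X in Ioi (0 : ℝ), ∫ t in Ioi (0 : ℝ), {p : ℝ × ℝ | σ * p.2 < p.1}.indicator
      (fun p : ℝ × ℝ => deriv (fun Y => φ Y p.2) p.1) (X, t)
      = -(σ⁻¹ * ∫ X in Ioi (0 : ℝ), φ X (X * σ⁻¹)) := by
  refine (integral_integral_swap
    (by exact integrable_indicator_deriv_left h hc (measurableSet_ahead σ))).trans ?_
  rw [← integral_line_param hσ]
  have := integral_deriv_right_behind (inv_pos.2 hσ) (contDiff_flip h) (hasCompactSupport_flip hc)
  simp only [inv_inv, flip, mul_comm _ σ] at this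
  rw [← this]
  congr with t
  congr with X
  simp only [indicator, mem_ofPred_eq, lt_inv_mul_iff₀ hσ]

lemma integral_deriv_left_behind (hσ : 0 < σ)
    (h : ContDiff ℝ 1 (fun p : ℝ × ℝ => φ p.1 p.2))
    (hc : HasCompactSupport (fun p : ℝ × ℝ => φ p.1 p.2)) :
    ∫ X in Ioi (0 : ℝ), ∫ t in Ioi (0 : ℝ), {p : ℝ × ℝ | p.1 < σ * p.2}.indicator
      (fun p : ℝ × ℝ => deriv (fun Y => φ Y p.2) p.1) (X, t)
      = σ⁻¹ * (∫ X in Ioi (0 : ℝ), φ X (X * σ⁻¹)) - ∫ t in Ioi (0 : ℝ), φ 0 t := by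
  refine (integral_integral_swap
    (by exact integrable_indicator_deriv_left h hc (measurableSet_behind σ))).trans ?_
  rw [← integral_line_param hσ]
  have := integral_deriv_right_ahead (inv_pos.2 hσ) (contDiff_flip h) (hasCompactSupport_flip hc)
  simp only [inv_inv, flip, mul_comm _ σ] at this
  rw [← this]
  congr with t
  congr with X
  simp only [indicator, mem_ofPred_eq, inv_mul_lt_iff₀ hσ]

/-- Splitting the double integral of a piecewise constant combination of the partial derivatives
into the part ahead of the line `X = σ t` and the part behind it. -/
lemma integral_piecewise (hσ : 0 < σ)
    (h : ContDiff ℝ 1 (fun p : ℝ × ℝ => φ p.1 p.2))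
    (hc : HasCompactSupport (fun p : ℝ × ℝ => φ p.1 p.2))
    {A B : ℝ → ℝ → ℝ} {a a' b b' : ℝ}
    (hA : ∀ X t, σ * t < X → A X t = a) (hA' : ∀ X t, X < σ * t → A X t = a')
    (hB : ∀ X t, σ * t < X → B X t = b) (hB' : ∀ X t, X < σ * t → B X t = b') :
    ∫ X in Ioi (0 : ℝ), ∫ t in Ioi (0 : ℝ),
        (A X t * deriv (fun τ => φ X τ) t - B X t * deriv (fun Y => φ Y t) X)
      = (a - a' + (b - b') * σ⁻¹) * (∫ X in Ioi (0 : ℝ), φ X (X * σ⁻¹))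
        - a * (∫ X in Ioi (0 : ℝ), φ X 0) + b' * ∫ t in Ioi (0 : ℝ), φ 0 t := by
  have i1 := (integrable_indicator_deriv_right h hc (measurableSet_ahead σ)).const_mul a
  have i2 := (integrable_indicator_deriv_right h hc (measurableSet_behind σ)).const_mul a'
  have i3 := (integrable_indicator_deriv_left h hc (measurableSet_ahead σ)).const_mul b
  have i4 := (integrable_indicator_deriv_left h hc (measurableSet_behind σ)).const_mul b'
  have i12 : Integrable (fun p : ℝ × ℝ => a * {p : ℝ × ℝ | σ * p.2 < p.1}.indicator
      (fun p : ℝ × ℝ => deriv (fun τ => φ p.1 τ) p.2) p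
      + a' * {p : ℝ × ℝ | p.1 < σ * p.2}.indicator
      (fun p : ℝ × ℝ => deriv (fun τ => φ p.1 τ) p.2) p)
      ((volume.restrict (Ioi (0 : ℝ))).prod (volume.restrict (Ioi (0 : ℝ)))) := i1.add i2
  have i34 : Integrable (fun p : ℝ × ℝ => b * {p : ℝ × ℝ | σ * p.2 < p.1}.indicator
      (fun p : ℝ × ℝ => deriv (fun Y => φ Y p.2) p.1) p
      + b' * {p : ℝ × ℝ | p.1 < σ * p.2}.indicator
      (fun p : ℝ × ℝ => deriv (fun Y => φ Y p.2) p.1) p)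
      ((volume.restrict (Ioi (0 : ℝ))).prod (volume.restrict (Ioi (0 : ℝ)))) := i3.add i4
  have split : ∀ X : ℝ, ∫ t in Ioi (0 : ℝ),
        (A X t * deriv (fun τ => φ X τ) t - B X t * deriv (fun Y => φ Y t) X)
      = ∫ t in Ioi (0 : ℝ),
        ((a * {p : ℝ × ℝ | σ * p.2 < p.1}.indicator
            (fun p : ℝ × ℝ => deriv (fun τ => φ p.1 τ) p.2) (X, t)
          + a' * {p : ℝ × ℝ | p.1 < σ * p.2}.indicator
            (fun p : ℝ × ℝ => deriv (fun τ => φ p.1 τ) p.2) (X, t))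
        - (b * {p : ℝ × ℝ | σ * p.2 < p.1}.indicator
            (fun p : ℝ × ℝ => deriv (fun Y => φ Y p.2) p.1) (X, t)
          + b' * {p : ℝ × ℝ | p.1 < σ * p.2}.indicator
            (fun p : ℝ × ℝ => deriv (fun Y => φ Y p.2) p.1) (X, t))) := by
    intro X
    refine integral_congr_ae (ae_restrict_of_ae ?_)
    filter_upwards [(measure_eq_zero_iff_ae_notMem).1 (measure_singleton (X / σ))] with t ht
    have hne : σ * t ≠ X := by
      rintro rfl
      exact ht (by simp [hσ.ne'])
    rcases lt_or_gt_of_ne hne with hlt | hlt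
    · simp [indicator, hA X t hlt, hB X t hlt, hlt, hlt.not_gt]
    · simp [indicator, hA' X t hlt, hB' X t hlt, hlt, hlt.not_gt]
  simp_rw [split]
  rw [integral_integral_sub i12 i34, integral_integral_add i1 i2,
    integral_integral_add i3 i4]
  simp_rw [integral_const_mul]
  rw [integral_deriv_right_ahead hσ h hc, integral_deriv_right_behind hσ h hc,
    integral_deriv_left_ahead hσ h hc, integral_deriv_left_behind hσ h hc]
  ring

end Slices

/-- For `P` with `P 0 = 0`, `V₀ > 0`, `Γₗ ∈ (−1,0)` satisfying the
Rankine–Hugoniot conditions `Γₗ·P(Γₗ) = V₀²`, `σ = −V₀/Γₗ`, the piecewise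
constant pair `V = −V₀` for `X > σt`, `V = 0` for `X < σt`; `Γ = 0` for `X > σt`,
`Γ = Γₗ` for `X < σt`, is a weak solution of the IBVP with data
`V(X,0) = −V₀`, `Γ(X,0) = 0`, `V(0,t) = 0`. -/
theorem stmt_4 (P : ℝ → ℝ) (hP0 : P 0 = 0) (V₀ Γl σ : ℝ)
    (hV₀ : 0 < V₀) (hΓl : Γl ∈ Set.Ioo (-1 : ℝ) 0)
    (hRH1 : Γl * P Γl = V₀ ^ 2) (hRH2 : σ = -V₀ / Γl)
    (V Γ : ℝ → ℝ → ℝ)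
    (hVgt : ∀ X t : ℝ, σ * t < X → V X t = -V₀)
    (hVlt : ∀ X t : ℝ, X < σ * t → V X t = 0)
    (hΓgt : ∀ X t : ℝ, σ * t < X → Γ X t = 0)
    (hΓlt : ∀ X t : ℝ, X < σ * t → Γ X t = Γl) :
    (∀ φ : ℝ → ℝ → ℝ, ContDiff ℝ 1 (fun p : ℝ × ℝ => φ p.1 p.2) →
        HasCompactSupport (fun p : ℝ × ℝ => φ p.1 p.2) →
        (∀ t : ℝ, φ 0 t = 0) →
        (∫ X in Set.Ioi (0 : ℝ), ∫ t in Set.Ioi (0 : ℝ),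
            (V X t * deriv (fun τ => φ X τ) t
              - P (Γ X t) * deriv (fun Y => φ Y t) X))
          + ∫ X in Set.Ioi (0 : ℝ), (-V₀) * φ X 0 = 0) ∧
      (∀ ψ : ℝ → ℝ → ℝ, ContDiff ℝ 1 (fun p : ℝ × ℝ => ψ p.1 p.2) →
        HasCompactSupport (fun p : ℝ × ℝ => ψ p.1 p.2) →
        (∫ X in Set.Ioi (0 : ℝ), ∫ t in Set.Ioi (0 : ℝ),
            (Γ X t * deriv (fun τ => ψ X τ) t
              - V X t * deriv (fun Y => ψ Y t) X)) = 0) := by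
  have hΓ0 : Γl < 0 := hΓl.2
  have hσ : 0 < σ := hRH2 ▸ div_pos_of_neg_of_neg (neg_lt_zero.2 hV₀) hΓ0
  have hσi : σ⁻¹ = -Γl / V₀ := by rw [hRH2, inv_div, div_neg, neg_div]
  refine ⟨fun φ h hc hφ0 => ?_, fun ψ h hc => ?_⟩
  · rw [integral_piecewise (A := V) (B := fun X t => P (Γ X t)) (b := 0) (b' := P Γl) hσ h hc
      hVgt hVlt (fun X t hX => by rw [hΓgt X t hX, hP0]) (fun X t hX => by rw [hΓlt X t hX])]
    have hcoef : -V₀ - 0 + (0 - P Γl) * σ⁻¹ = 0 := by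
      rw [hσi]
      field_simp
      linarith
    rw [hcoef, integral_const_mul]
    simp [hφ0]
  · rw [integral_piecewise hσ h hc hΓgt hΓlt hVgt hVlt]
    have hcoef : 0 - Γl + (-V₀ - 0) * σ⁻¹ = 0 := by
      rw [hσi]
      field_simp
      ring
    rw [hcoef]
    ring
end

section
/- Let P be C³ on a neighborhood of 0 with P(0)=0, P'(0)>0 and P''(0)<0. Let Φ, Ψ be C³ real functions of two variables (V,Γ) defined on a neighborhood of (0,0) such that: Φ is strictly convex (its Hessian is positive definite), Φ_{ΓΓ}(V,Γ) = P'(Γ)·Φ_{VV}(V,Γ), Ψ_V = −Φ_Γ and Ψ_Γ = −P'(Γ)·Φ_V. For Γ<0 near 0 put ε(Γ) = −√(Γ·P(Γ)) and σ(Γ) = ε(Γ)/Γ, and define E(Γ) = σ(Γ)·[Φ(0,Γ) − Φ(ε(Γ),0)] − [Ψ(0,Γ) − Ψ(ε(Γ),0)]. Then there exists δ>0 such that E(Γ) ≤ 0 for all Γ with −δ < Γ < 0; that is, the compression-shock solution S(Γ) satisfies the entropy jump condition corresponding to (Φ,Ψ) for all Γ ≤ 0 sufficiently close to zero. -/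
open Set Filter

/-- The first partial derivative of a differentiable function, as a value of `fderiv`. -/
lemma hasDerivAt_slice_fst {f : ℝ × ℝ → ℝ} {p : ℝ × ℝ} (h : DifferentiableAt ℝ f p) :
    HasDerivAt (fun v => f (v, p.2)) (fderiv ℝ f p (1, 0)) p.1 :=
  h.hasFDerivAt.comp_hasDerivAt_of_eq p.1
    ((hasDerivAt_id p.1).prodMk (hasDerivAt_const p.1 p.2)) rfl

/-- The second partial derivative of a differentiable function, as a value of `fderiv`. -/
lemma hasDerivAt_slice_snd {f : ℝ × ℝ → ℝ} {p : ℝ × ℝ} (h : DifferentiableAt ℝ f p) :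
    HasDerivAt (fun γ => f (p.1, γ)) (fderiv ℝ f p (0, 1)) p.2 :=
  h.hasFDerivAt.comp_hasDerivAt_of_eq p.2
    ((hasDerivAt_const p.2 p.1).prodMk (hasDerivAt_id p.2)) rfl

/-- The derivative of a function of two variables along the segment from `(a, 0)` to `(0, b)`. -/
lemma hasDerivAt_comp_segment {f : ℝ × ℝ → ℝ} {a b s : ℝ}
    (h : DifferentiableAt ℝ f (a * (1 - s), s * b)) :
    HasDerivAt (fun t => f (a * (1 - t), t * b))
      (-a * fderiv ℝ f (a * (1 - s), s * b) (1, 0)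
        + b * fderiv ℝ f (a * (1 - s), s * b) (0, 1)) s := by
  have hγ : HasDerivAt (fun t : ℝ => (a * (1 - t), t * b)) (-a, b) s := by
    refine HasDerivAt.prodMk ?_ ?_
    · simpa using ((hasDerivAt_id s).const_sub 1).const_mul a
    · simpa using (hasDerivAt_id s).mul_const b
  have := h.hasFDerivAt.comp_hasDerivAt s hγ
  refine this.congr_deriv ?_
  have e : ((-a, b) : ℝ × ℝ) = (-a) • (1, 0) + b • (0, 1) := by simp
  rw [e, map_add, map_smul, map_smul, smul_eq_mul, smul_eq_mul]

/-- A `C²` function with negative second derivative at `0` is concave around `0`. -/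
lemma exists_concaveOn_Ioo {P : ℝ → ℝ} (hP : ContDiffAt ℝ 2 P 0)
    (hP2 : deriv (deriv P) 0 < 0) :
    ∃ r > 0, ConcaveOn ℝ (Ioo (-r) r) P ∧ ∀ x ∈ Ioo (-r) r, DifferentiableAt ℝ P x := by
  have h1 : ContDiffAt ℝ 1 (deriv P) 0 := hP.derivWithin (by norm_num)
  have h2 : ContDiffAt ℝ 0 (deriv (deriv P)) 0 := h1.derivWithin (by norm_num)
  have e1 : ∀ᶠ x in nhds (0 : ℝ), DifferentiableAt ℝ P x :=
    (hP.eventually (by simp)).mono fun x hx => hx.differentiableAt (by norm_num)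
  have e2 : ∀ᶠ x in nhds (0 : ℝ), DifferentiableAt ℝ (deriv P) x :=
    (h1.eventually (by simp)).mono fun x hx => hx.differentiableAt (by norm_num)
  have e3 : ∀ᶠ x in nhds (0 : ℝ), deriv (deriv P) x < 0 :=
    h2.continuousAt.eventually_lt_const hP2
  obtain ⟨r, hr, H⟩ := Metric.eventually_nhds_iff_ball.1 (e1.and (e2.and e3))
  simp only [Real.ball_eq_Ioo, zero_sub, zero_add] at H
  refine ⟨r, hr, ?_, fun x hx => (H x hx).1⟩
  refine concaveOn_of_deriv2_nonpos (convex_Ioo _ _)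
    (fun x hx => (H x hx).1.continuousAt.continuousWithinAt) ?_ ?_ ?_
  all_goals rw [interior_Ioo]
  · exact fun x hx => (H x hx).1.differentiableWithinAt
  · exact fun x hx => (H x hx).2.1.differentiableWithinAt
  · exact fun x hx => (H x hx).2.2.le

/-- Directional derivatives lose one order of smoothness. -/
lemma contDiffAt_fderiv_apply {f : ℝ × ℝ → ℝ} {p : ℝ × ℝ} {m n : WithTop ℕ∞}
    (h : ContDiffAt ℝ n f p) (hmn : m + 1 ≤ n) (u : ℝ × ℝ) :
    ContDiffAt ℝ m (fun q => fderiv ℝ f q u) p :=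
  (h.fderiv_right hmn).clm_apply contDiffAt_const

/-- If `P` is concave and the derivative of `Φ_V` along the segment from `(ε, 0)` to `(0, Γ)` is
nonnegative, then the entropy jump across the shock joining these states is nonpositive. -/
lemma entropy_jump_nonpos {P : ℝ → ℝ} {f g : ℝ × ℝ → ℝ} {ε Γ σ : ℝ}
    (hP0 : P 0 = 0) (hσ : σ * Γ = ε) (hσ' : σ * ε = P Γ)
    (hw : ∀ s ∈ Icc (0 : ℝ) 1, s * P Γ ≤ P (s * Γ))
    (hPd : ∀ s ∈ Icc (0 : ℝ) 1, DifferentiableAt ℝ P (s * Γ))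
    (hf : ∀ s ∈ Icc (0 : ℝ) 1, DifferentiableAt ℝ f (ε * (1 - s), s * Γ))
    (hg : ∀ s ∈ Icc (0 : ℝ) 1, DifferentiableAt ℝ g (ε * (1 - s), s * Γ))
    (hf' : ∀ s ∈ Icc (0 : ℝ) 1,
      DifferentiableAt ℝ (fun q => fderiv ℝ f q (1, 0)) (ε * (1 - s), s * Γ))
    (h1 : ∀ s ∈ Icc (0 : ℝ) 1, fderiv ℝ g (ε * (1 - s), s * Γ) (1, 0)
      = -fderiv ℝ f (ε * (1 - s), s * Γ) (0, 1))
    (h2 : ∀ s ∈ Icc (0 : ℝ) 1, fderiv ℝ g (ε * (1 - s), s * Γ) (0, 1)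
      = -deriv P (s * Γ) * fderiv ℝ f (ε * (1 - s), s * Γ) (1, 0))
    (hpos : ∀ s ∈ Icc (0 : ℝ) 1,
      0 ≤ -ε * fderiv ℝ (fun q => fderiv ℝ f q (1, 0)) (ε * (1 - s), s * Γ) (1, 0)
        + Γ * fderiv ℝ (fun q => fderiv ℝ f q (1, 0)) (ε * (1 - s), s * Γ) (0, 1)) :
    σ * (f (0, Γ) - f (ε, 0)) - (g (0, Γ) - g (ε, 0)) ≤ 0 := by
  have key : ∀ s ∈ Icc (0 : ℝ) 1, HasDerivAt
      (fun t => σ * f (ε * (1 - t), t * Γ) - g (ε * (1 - t), t * Γ)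
        - fderiv ℝ f (ε * (1 - t), t * Γ) (1, 0) * (P (t * Γ) - t * P Γ))
      (-((-ε * fderiv ℝ (fun q => fderiv ℝ f q (1, 0)) (ε * (1 - s), s * Γ) (1, 0)
        + Γ * fderiv ℝ (fun q => fderiv ℝ f q (1, 0)) (ε * (1 - s), s * Γ) (0, 1))
        * (P (s * Γ) - s * P Γ))) s := by
    intro s hs
    have hPs : HasDerivAt (fun t => P (t * Γ)) (deriv P (s * Γ) * Γ) s := by
      have := (hPd s hs).hasDerivAt.comp s ((hasDerivAt_id s).mul_const Γ)
      simpa [Function.comp_def] using this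
    have hlin : HasDerivAt (fun t => t * P Γ) (P Γ) s := by
      simpa using (hasDerivAt_id s).mul_const (P Γ)
    refine ((((hasDerivAt_comp_segment (hf s hs)).const_mul σ).sub
      (hasDerivAt_comp_segment (hg s hs))).sub
      ((hasDerivAt_comp_segment (hf' s hs)).mul (hPs.sub hlin))).congr_deriv ?_
    rw [h1 s hs, h2 s hs, Pi.sub_apply]
    linear_combination (fderiv ℝ f (ε * (1 - s), s * Γ) (0, 1)) * hσ
      - (fderiv ℝ f (ε * (1 - s), s * Γ) (1, 0)) * hσ'
  have hanti := antitoneOn_of_deriv_nonpos (convex_Icc (0 : ℝ) 1)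
    (fun s hs => (key s hs).continuousAt.continuousWithinAt)
    (fun s hs => (key s (interior_subset hs)).differentiableAt.differentiableWithinAt)
    (fun s hs => by
      have hs := interior_subset hs
      rw [(key s hs).deriv, neg_nonpos]
      exact mul_nonneg (hpos s hs) (sub_nonneg.2 (hw s hs)))
  have := hanti (left_mem_Icc.2 zero_le_one) (right_mem_Icc.2 zero_le_one) zero_le_one
  simp only [sub_self, mul_zero, one_mul, sub_zero, mul_one, zero_mul, hP0] at this
  linarith

/-- Let `P` be C³ near `0` with `P 0 = 0`, `P'(0) > 0`, `P''(0) < 0`.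
Let `Φ, Ψ` be C³ near `(0,0)` such that on a neighborhood `U` of `(0,0)`:
the Hessian of `Φ` is positive definite (strict convexity), the integrability
condition `Φ_ΓΓ = P'(Γ)·Φ_VV` holds, and the entropy-flux relations
`Ψ_V = −Φ_Γ`, `Ψ_Γ = −P'(Γ)·Φ_V` hold. With `ε(Γ) = −√(Γ·P(Γ))`, `σ(Γ) = ε(Γ)/Γ`
and `E(Γ) = σ(Γ)[Φ(0,Γ) − Φ(ε(Γ),0)] − [Ψ(0,Γ) − Ψ(ε(Γ),0)]`, there is `δ > 0`
with `E(Γ) ≤ 0` for all `−δ < Γ < 0` (the entropy jump condition holds near 0). -/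
theorem stmt_6 (P : ℝ → ℝ) (Φ Ψ : ℝ → ℝ → ℝ) (U : Set (ℝ × ℝ))
    (hU : U ∈ nhds ((0 : ℝ), (0 : ℝ)))
    (hP : ContDiffAt ℝ 3 P 0) (hP0 : P 0 = 0)
    (hP1 : 0 < deriv P 0) (hP2 : deriv (deriv P) 0 < 0)
    (hΦ : ContDiffAt ℝ 3 (fun p : ℝ × ℝ => Φ p.1 p.2) (0, 0))
    (hΨ : ContDiffAt ℝ 3 (fun p : ℝ × ℝ => Ψ p.1 p.2) (0, 0))
    (hconv : ∀ p ∈ U, ∀ x y : ℝ, (x, y) ≠ ((0 : ℝ), (0 : ℝ)) →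
      0 < deriv (fun v => deriv (fun v' => Φ v' p.2) v) p.1 * x ^ 2
          + 2 * deriv (fun γ => deriv (fun v' => Φ v' γ) p.1) p.2 * x * y
          + deriv (fun γ => deriv (fun γ' => Φ p.1 γ') γ) p.2 * y ^ 2)
    (hint : ∀ p ∈ U,
      deriv (fun γ => deriv (fun γ' => Φ p.1 γ') γ) p.2
        = deriv P p.2 * deriv (fun v => deriv (fun v' => Φ v' p.2) v) p.1)
    (hflux1 : ∀ p ∈ U, deriv (fun v => Ψ v p.2) p.1 = -deriv (fun γ => Φ p.1 γ) p.2)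
    (hflux2 : ∀ p ∈ U,
      deriv (fun γ => Ψ p.1 γ) p.2 = -(deriv P p.2) * deriv (fun v => Φ v p.2) p.1) :
    ∃ δ > (0 : ℝ), ∀ Γ : ℝ, -δ < Γ → Γ < 0 →
      (-Real.sqrt (Γ * P Γ) / Γ) * (Φ 0 Γ - Φ (-Real.sqrt (Γ * P Γ)) 0)
        - (Ψ 0 Γ - Ψ (-Real.sqrt (Γ * P Γ)) 0) ≤ 0 := by
  set f : ℝ × ℝ → ℝ := fun p => Φ p.1 p.2
  set g : ℝ × ℝ → ℝ := fun p => Ψ p.1 p.2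
  set G : ℝ × ℝ → ℝ := fun q => fderiv ℝ f q (1, 0)
  have hGc : ContDiffAt ℝ 2 G (0, 0) := contDiffAt_fderiv_apply hΦ (by norm_num) _
  have hAc : ContDiffAt ℝ 1 (fun q => fderiv ℝ G q (1, 0)) (0, 0) :=
    contDiffAt_fderiv_apply hGc (by norm_num) _
  have hBc : ContDiffAt ℝ 1 (fun q => fderiv ℝ G q (0, 1)) (0, 0) :=
    contDiffAt_fderiv_apply hGc (by norm_num) _
  have ef : ∀ᶠ p in nhds ((0 : ℝ), (0 : ℝ)), DifferentiableAt ℝ f p :=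
    (hΦ.eventually (by simp)).mono fun x hx => hx.differentiableAt (by norm_num)
  have eg : ∀ᶠ p in nhds ((0 : ℝ), (0 : ℝ)), DifferentiableAt ℝ g p :=
    (hΨ.eventually (by simp)).mono fun x hx => hx.differentiableAt (by norm_num)
  have eG : ∀ᶠ p in nhds ((0 : ℝ), (0 : ℝ)), DifferentiableAt ℝ G p :=
    (hGc.eventually (by simp)).mono fun x hx => hx.differentiableAt (by norm_num)
  have efG : ∀ᶠ p : ℝ × ℝ in nhds (0, 0), deriv (fun v => Φ v p.2) p.1 = G p :=
    ef.mono fun p hp => (hasDerivAt_slice_fst hp).deriv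
  have hG0 : DifferentiableAt ℝ G (0, 0) := eG.self_of_nhds
  have hA0 : deriv (fun v => deriv (fun v' => Φ v' 0) v) 0 = fderiv ℝ G (0, 0) (1, 0) := by
    rw [← (hasDerivAt_slice_fst hG0).deriv]
    refine EventuallyEq.deriv_eq ?_
    have : Tendsto (fun v : ℝ => (v, (0 : ℝ))) (nhds 0) (nhds (0, 0)) :=
      Continuous.tendsto' (by fun_prop) _ _ rfl
    exact this.eventually efG
  have hB0 : deriv (fun γ => deriv (fun v' => Φ v' γ) 0) 0 = fderiv ℝ G (0, 0) (0, 1) := by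
    rw [← (hasDerivAt_slice_snd hG0).deriv]
    refine EventuallyEq.deriv_eq ?_
    have : Tendsto (fun γ : ℝ => ((0 : ℝ), γ)) (nhds 0) (nhds (0, 0)) :=
      Continuous.tendsto' (by fun_prop) _ _ rfl
    exact this.eventually efG
  have hc : 0 < √(deriv P 0) := Real.sqrt_pos.2 hP1
  have hdef : 0 < √(deriv P 0) * fderiv ℝ G (0, 0) (1, 0) - fderiv ℝ G (0, 0) (0, 1) := by
    have h := hconv (0, 0) (mem_of_mem_nhds hU) (√(deriv P 0)) (-1) (by simp)
    have h' := hint (0, 0) (mem_of_mem_nhds hU)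
    simp only at h h'
    rw [h', hA0, hB0, Real.sq_sqrt hP1.le] at h
    refine pos_of_mul_pos_right (a := 2 * √(deriv P 0)) ?_ (by positivity)
    have hsq := Real.mul_self_sqrt hP1.le
    linear_combination h - 2 * fderiv ℝ G (0, 0) (1, 0) * hsq
  have hslope : Tendsto (fun Γ => √(P Γ / Γ)) (nhdsWithin 0 (Iio 0)) (nhds (√(deriv P 0))) := by
    refine (Real.continuous_sqrt.tendsto _).comp ?_
    have h := (hP.differentiableAt (by norm_num)).hasDerivAt.tendsto_slope
    have h' := h.mono_left (nhdsWithin_mono 0 (fun x (hx : x < 0) => hx.ne))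
    refine h'.congr fun x => ?_
    simp [slope_def_field, hP0]
  have epos : ∀ᶠ q : ℝ × (ℝ × ℝ) in nhdsWithin 0 (Iio 0) ×ˢ nhds (0, 0),
      0 < √(P q.1 / q.1) * fderiv ℝ G q.2 (1, 0) - fderiv ℝ G q.2 (0, 1) := by
    refine Tendsto.eventually_const_lt hdef ?_
    exact ((hslope.comp tendsto_fst).mul (hAc.continuousAt.tendsto.comp tendsto_snd)).sub
      (hBc.continuousAt.tendsto.comp tendsto_snd)
  obtain ⟨pa, hpa, pb, hpb, hab⟩ := eventually_prod_iff.1 epos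
  obtain ⟨r, hr, H⟩ := Metric.eventually_nhds_iff_ball.1
    (hpb.and (ef.and (eg.and (eG.and hU))))
  obtain ⟨ρ, hρ, hconc, hPd⟩ := exists_concaveOn_Ioo (hP.of_le (by norm_num)) hP2
  have hε : Tendsto (fun Γ => √(Γ * P Γ)) (nhdsWithin 0 (Iio 0)) (nhds 0) := by
    have : ContinuousAt (fun Γ => √(Γ * P Γ)) 0 :=
      (continuousAt_id.mul hP.continuousAt).sqrt
    have h := this.tendsto.mono_left (nhdsWithin_le_nhds (s := Iio 0))
    simpa using h
  have hPneg : ∀ᶠ Γ in nhdsWithin 0 (Iio 0), 0 < √(P Γ / Γ) := hslope.eventually_const_lt hc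
  have hsmall : ∀ᶠ Γ in nhdsWithin (0 : ℝ) (Iio 0), -min r ρ < Γ :=
    nhdsWithin_le_nhds (lt_mem_nhds (by simpa using ⟨hr, hρ⟩))
  obtain ⟨l, hl, hl'⟩ := (mem_nhdsLT_iff_exists_Ioo_subset).1
    (hpa.and (hPneg.and (hsmall.and (hε.eventually_lt_const hr))))
  refine ⟨-l, neg_pos.2 hl, fun Γ hΓ hΓ0 => ?_⟩
  obtain ⟨ha, hk, hΓs, hεr⟩ := hl' ⟨by simpa using hΓ, hΓ0⟩
  have hPΓ : 0 < P Γ / Γ := Real.sqrt_pos.1 hk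
  have hk2 : √(P Γ / Γ) * √(P Γ / Γ) = P Γ / Γ := Real.mul_self_sqrt hPΓ.le
  have hΓr : -r < Γ := (neg_le_neg (min_le_left r ρ)).trans_lt hΓs
  have hΓρ : -ρ < Γ := (neg_le_neg (min_le_right r ρ)).trans_lt hΓs
  have hεk : -√(Γ * P Γ) = Γ * √(P Γ / Γ) := by
    have : Γ * P Γ = Γ ^ 2 * (P Γ / Γ) := by field_simp
    rw [this, Real.sqrt_mul (sq_nonneg Γ), Real.sqrt_sq_eq_abs, abs_of_neg hΓ0]
    ring
  have hmem : ∀ s ∈ Icc (0 : ℝ) 1,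
      (-√(Γ * P Γ) * (1 - s), s * Γ) ∈ Metric.ball ((0 : ℝ), (0 : ℝ)) r := by
    intro s ⟨hs0, hs1⟩
    have hε0 := Real.sqrt_nonneg (Γ * P Γ)
    rw [← ball_prod_same, Real.ball_eq_Ioo]
    refine ⟨⟨?_, ?_⟩, ?_, ?_⟩ <;> simp only <;> nlinarith
  have hmemρ : ∀ s ∈ Icc (0 : ℝ) 1, s * Γ ∈ Ioo (-ρ) ρ := by
    intro s ⟨hs0, hs1⟩
    constructor <;> nlinarith
  refine entropy_jump_nonpos (P := P) (f := f) (g := g) hP0 (div_mul_cancel₀ _ hΓ0.ne) ?_ ?_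
    (fun s hs => hPd _ (hmemρ s hs)) (fun s hs => (H _ (hmem s hs)).2.1)
    (fun s hs => (H _ (hmem s hs)).2.2.1) (fun s hs => (H _ (hmem s hs)).2.2.2.1) ?_ ?_ ?_
  · rw [hεk, mul_div_cancel_left₀ _ hΓ0.ne, mul_left_comm, hk2, mul_div_cancel₀ _ hΓ0.ne]
  · intro s hs
    have h := hconc.2 (x := Γ) (y := 0) ⟨hΓρ, hΓ0.trans hρ⟩ ⟨neg_lt_zero.2 hρ, hρ⟩ hs.1
      (sub_nonneg.2 hs.2) (by ring)
    simpa [hP0] using h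
  · intro s hs
    obtain ⟨-, hfs, hgs, -, hUs⟩ := H _ (hmem s hs)
    rw [← (hasDerivAt_slice_fst hgs).deriv, ← (hasDerivAt_slice_snd hfs).deriv]
    exact hflux1 _ hUs
  · intro s hs
    obtain ⟨-, hfs, hgs, -, hUs⟩ := H _ (hmem s hs)
    rw [← (hasDerivAt_slice_snd hgs).deriv, ← (hasDerivAt_slice_fst hfs).deriv]
    exact hflux2 _ hUs
  · intro s hs
    have h := hab ha (H _ (hmem s hs)).1
    simp only at h
    rw [hεk] at h ⊢
    have := mul_pos (neg_pos.2 hΓ0) h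
    refine this.le.trans_eq ?_
    ring
end

section
/- Let λ, μ, ρ₀ > 0 and define the St.Venant–Kirchhoff stress function P(Γ) = ((λ+2μ)/(2ρ₀))·(1+Γ)(2+Γ)Γ. Then for every Γ_l ∈ (−1,0), 2·∫₀^{Γ_l} P(w) dw > Γ_l · P(Γ_l); that is, the compression-shock solution S(Γ_l) fails the entropy condition corresponding to the standard entropy function for every Γ_l ∈ (−1,0). -/
open intervalIntegral

/-- For the St.Venant–Kirchhoff stress function
`P(Γ) = ((λ+2μ)/(2ρ₀))(1+Γ)(2+Γ)Γ` with `λ, μ, ρ₀ > 0`, the compression-shock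
solution fails the standard entropy condition for every `Γₗ ∈ (−1,0)`:
`2∫₀^{Γₗ} P > Γₗ · P(Γₗ)`. -/
theorem stmt_13 (lam mu rho : ℝ) (hlam : 0 < lam) (hmu : 0 < mu) (hrho : 0 < rho)
    (P : ℝ → ℝ)
    (hP : ∀ Γ : ℝ, P Γ = ((lam + 2 * mu) / (2 * rho)) * (1 + Γ) * (2 + Γ) * Γ) :
    ∀ Γl ∈ Set.Ioo (-1 : ℝ) 0, Γl * P Γl < 2 * ∫ w in (0 : ℝ)..Γl, P w := by
  intro Γl ⟨hl, hr⟩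
  have hc : 0 < (lam + 2 * mu) / (2 * rho) := by positivity
  set c := (lam + 2 * mu) / (2 * rho)
  have hint : ∫ w in (0 : ℝ)..Γl, P w = c * (Γl ^ 2 + Γl ^ 3 + Γl ^ 4 / 4) := by
    have hderiv : ∀ x ∈ Set.uIcc 0 Γl,
        HasDerivAt (fun w : ℝ => c * (w ^ 2 + w ^ 3 + w ^ 4 / 4)) (P x) x := by
      intro x _
      refine ((((hasDerivAt_pow 2 x).add (hasDerivAt_pow 3 x)).add
        ((hasDerivAt_pow 4 x).div_const 4)).const_mul c).congr_deriv ?_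
      rw [hP]
      norm_num
      ring
    have hcont : Continuous P := by
      rw [funext hP]
      fun_prop
    rw [integral_eq_sub_of_hasDerivAt hderiv (hcont.intervalIntegrable _ _)]
    ring
  rw [hint, hP]
  have hpos : 0 < c * ((-Γl) ^ 3 * (1 + Γl / 2)) :=
    mul_pos hc (mul_pos (pow_pos (by linarith) 3) (by linarith))
  linarith
end

section
/- Let λ, μ, ρ₀ > 0, set α = λ/μ, and define the modified Kirchhoff stress function P(Γ) = (1/ρ₀)·(μ(1+Γ)³ − μ(1+Γ) + λ·ln(1+Γ)/(1+Γ)) for Γ > −1. Then P''(Γ) < 0 for all Γ ∈ (−1, 0] if and only if α > 2. -/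
/-- The second derivative of the modified Kirchhoff stress function. -/
theorem deriv_deriv_kirchhoff_stress (lam mu rho : ℝ) (P : ℝ → ℝ)
    (hP : ∀ Γ : ℝ, -1 < Γ →
      P Γ = (1 / rho) * (mu * (1 + Γ) ^ 3 - mu * (1 + Γ) + lam * Real.log (1 + Γ) / (1 + Γ)))
    {Γ : ℝ} (hΓ : -1 < Γ) :
    deriv (deriv P) Γ =
      (1 / rho) * (6 * mu * (1 + Γ) + lam * (2 * Real.log (1 + Γ) - 3) / (1 + Γ) ^ 3) := by
  have hderiv : ∀ x : ℝ, -1 < x → deriv P x =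
      (1 / rho) * (3 * mu * (1 + x) ^ 2 - mu + lam * (1 - Real.log (1 + x)) / (1 + x) ^ 2) := by
    intro x hx
    have hs : (1 + x) ≠ 0 := by linarith
    have hadd : HasDerivAt (fun y : ℝ => 1 + y) 1 x := (hasDerivAt_id x).const_add 1
    have heq : P =ᶠ[nhds x] fun y =>
        (1 / rho) * (mu * (1 + y) ^ 3 - mu * (1 + y) + lam * Real.log (1 + y) / (1 + y)) :=
      (eventually_gt_nhds hx).mono hP
    rw [heq.deriv_eq]
    refine (((((hadd.fun_pow 3).const_mul mu).fun_sub (hadd.const_mul mu)).fun_add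
      (((hadd.log hs).const_mul lam).fun_div hadd hs)).const_mul (1 / rho)).deriv.trans ?_
    congr 1
    field_simp
    ring
  have hs : (1 + Γ) ≠ 0 := by linarith
  have hadd : HasDerivAt (fun y : ℝ => 1 + y) 1 Γ := (hasDerivAt_id Γ).const_add 1
  have heq : deriv P =ᶠ[nhds Γ] fun y =>
      (1 / rho) * (3 * mu * (1 + y) ^ 2 - mu + lam * (1 - Real.log (1 + y)) / (1 + y) ^ 2) :=
    (eventually_gt_nhds hΓ).mono hderiv
  rw [heq.deriv_eq]
  refine (((((hadd.fun_pow 2).const_mul (3 * mu)).sub_const mu).fun_add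
    ((((hadd.log hs).const_sub 1).const_mul lam).fun_div (hadd.fun_pow 2)
      (pow_ne_zero 2 hs))).const_mul (1 / rho)).deriv.trans ?_
  congr 1
  field_simp
  ring

/-- For the modified Kirchhoff stress function
`P(Γ) = (1/ρ₀)(μ(1+Γ)³ − μ(1+Γ) + λ ln(1+Γ)/(1+Γ))` with `λ, μ, ρ₀ > 0` and
`α = λ/μ`: genuine nonlinearity `P'' < 0` holds on all of `(−1,0]` iff `α > 2`. -/
theorem stmt_14 (lam mu rho : ℝ) (hlam : 0 < lam) (hmu : 0 < mu) (hrho : 0 < rho)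
    (P : ℝ → ℝ)
    (hP : ∀ Γ : ℝ, -1 < Γ →
      P Γ = (1 / rho) * (mu * (1 + Γ) ^ 3 - mu * (1 + Γ) + lam * Real.log (1 + Γ) / (1 + Γ))) :
    (∀ Γ ∈ Set.Ioc (-1 : ℝ) 0, deriv (deriv P) Γ < 0) ↔ 2 < lam / mu := by
  rw [lt_div_iff₀ hmu]
  constructor
  · intro h
    have h0 := h 0 (by norm_num)
    rw [deriv_deriv_kirchhoff_stress lam mu rho P hP (by norm_num)] at h0
    have h1 := neg_of_mul_neg_right h0 (by positivity)
    norm_num at h1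
    linarith
  · rintro h Γ ⟨hΓ, hΓ0⟩
    rw [deriv_deriv_kirchhoff_stress lam mu rho P hP hΓ]
    have hs : 0 < 1 + Γ := by linarith
    have hs1 : 1 + Γ ≤ 1 := by linarith
    have hlog : Real.log (1 + Γ) ≤ 0 := Real.log_nonpos hs.le hs1
    have hpow : mu * (1 + Γ) ^ 4 ≤ mu := mul_le_of_le_one_right hmu.le (pow_le_one₀ hs.le hs1)
    have hmul : lam * Real.log (1 + Γ) ≤ 0 := mul_nonpos_of_nonneg_of_nonpos hlam.le hlog
    refine mul_neg_of_pos_of_neg (by positivity) ?_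
    have heq : 6 * mu * (1 + Γ) + lam * (2 * Real.log (1 + Γ) - 3) / (1 + Γ) ^ 3 =
        (6 * (mu * (1 + Γ) ^ 4) + 2 * (lam * Real.log (1 + Γ)) - 3 * lam) / (1 + Γ) ^ 3 := by
      field_simp
      ring
    rw [heq]
    exact div_neg_of_neg_of_pos (by linarith) (by positivity)
end

section
/- Let λ, μ, ρ₀ > 0 with λ/μ ≥ 2, and define the modified Kirchhoff stress function P(Γ) = (1/ρ₀)·(μ(1+Γ)³ − μ(1+Γ) + λ·ln(1+Γ)/(1+Γ)) for Γ > −1. Then for every Γ_l ∈ (−1,0), 2·∫₀^{Γ_l} P(w) dw ≤ Γ_l · P(Γ_l); that is, the compression-shock solution S(Γ_l) satisfies the entropy condition corresponding to the standard entropy function for all Γ_l ∈ (−1,0). -/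
open intervalIntegral

/-- An upper bound for `-log` on `(0, 1]`, obtained from `s ≤ sinh s` at `s = -log t`. -/
lemma neg_log_le_half_inv_sub_self {t : ℝ} (ht : 0 < t) (ht1 : t ≤ 1) :
    -Real.log t ≤ (t⁻¹ - t) / 2 := by
  have h := Real.self_le_sinh_iff.2 (neg_nonneg.2 (Real.log_nonpos ht.le ht1))
  rwa [Real.sinh_eq, neg_neg, Real.exp_neg, Real.exp_log ht] at h

/-- The logarithmic part of the entropy inequality, with `t = 1 + Γ`. -/
lemma one_sub_pow_three_le_log_defect {t : ℝ} (ht : 0 < t) (ht1 : t ≤ 1) :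
    (1 - t) ^ 3 / 2 ≤ (t - 1) * (Real.log t / t) - Real.log t ^ 2 := by
  have hs := Real.log_le_sub_one_of_pos ht
  have hupper := neg_log_le_half_inv_sub_self ht ht1
  have hsq : (1 - t) ^ 2 / 2 ≤ t⁻¹ - 1 + Real.log t := by
    have hinv : 1 ≤ t⁻¹ := (one_le_inv₀ ht).2 ht1
    have hmul : t * t⁻¹ = 1 := mul_inv_cancel₀ ht.ne'
    have : (1 - t) ^ 2 ≤ (1 - t) ^ 2 * t⁻¹ := le_mul_of_one_le_right (sq_nonneg _) hinv
    have : (1 - t) ^ 2 * t⁻¹ = t⁻¹ - 2 + t := by field_simp; ring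
    linarith
  calc (1 - t) ^ 3 / 2 = (1 - t) * ((1 - t) ^ 2 / 2) := by ring
    _ ≤ -Real.log t * (t⁻¹ - 1 + Real.log t) :=
        mul_le_mul (by linarith) hsq (by positivity) (by linarith)
    _ = (t - 1) * (Real.log t / t) - Real.log t ^ 2 := by field_simp; ring

/-- The stored energy of the modified Kirchhoff model. -/
lemma integral_modified_kirchhoff_stress (lam mu rho : ℝ) {P : ℝ → ℝ}
    (hP : ∀ Γ : ℝ, -1 < Γ →
      P Γ = (1 / rho) * (mu * (1 + Γ) ^ 3 - mu * (1 + Γ) + lam * Real.log (1 + Γ) / (1 + Γ)))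
    {x : ℝ} (hx : -1 < x) :
    ∫ w in (0 : ℝ)..x, P w =
      (1 / rho) * (mu * ((1 + x) ^ 2 - 1) ^ 2 / 4 + lam * Real.log (1 + x) ^ 2 / 2) := by
  have hgt : ∀ w ∈ Set.uIcc 0 x, -1 < w := fun w hw =>
    lt_of_lt_of_le (lt_min (by norm_num) hx) hw.1
  have hderiv : ∀ w ∈ Set.uIcc 0 x, HasDerivAt
      (fun y => (1 / rho) * (mu * ((1 + y) ^ 2 - 1) ^ 2 / 4 + lam * Real.log (1 + y) ^ 2 / 2))
      (P w) w := by
    intro w hw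
    have hw1 : 1 + w ≠ 0 := by linarith [hgt w hw]
    have hid : HasDerivAt (fun y : ℝ => 1 + y) 1 w := (hasDerivAt_id w).const_add 1
    have hpoly := ((((hid.pow 2).sub_const 1).pow 2).const_mul mu).div_const 4
    have hlog := (((hid.log hw1).pow 2).const_mul lam).div_const 2
    refine ((hpoly.add hlog).const_mul (1 / rho)).congr_deriv ?_
    rw [hP w (hgt w hw)]
    simp only [Pi.pow_apply]
    push_cast
    field_simp
    ring
  have hcont : ContinuousOn P (Set.uIcc 0 x) := by
    refine ContinuousOn.congr (fun w hw => ?_) fun w hw => hP w (hgt w hw)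
    have hw1 : 1 + w ≠ 0 := by linarith [hgt w hw]
    exact ContinuousAt.continuousWithinAt (by fun_prop (disch := assumption))
  rw [integral_eq_sub_of_hasDerivAt hderiv hcont.intervalIntegrable]
  simp

/-- For the modified Kirchhoff stress function
`P(Γ) = (1/ρ₀)(μ(1+Γ)³ − μ(1+Γ) + λ ln(1+Γ)/(1+Γ))` with `λ, μ, ρ₀ > 0` and
`λ/μ ≥ 2`, the compression-shock solution satisfies the standard entropy condition
`2∫₀^{Γₗ} P ≤ Γₗ · P(Γₗ)` for all `Γₗ ∈ (−1,0)`. -/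
theorem stmt_15 (lam mu rho : ℝ) (hlam : 0 < lam) (hmu : 0 < mu) (hrho : 0 < rho)
    (hratio : 2 ≤ lam / mu)
    (P : ℝ → ℝ)
    (hP : ∀ Γ : ℝ, -1 < Γ →
      P Γ = (1 / rho) * (mu * (1 + Γ) ^ 3 - mu * (1 + Γ) + lam * Real.log (1 + Γ) / (1 + Γ))) :
    ∀ Γl ∈ Set.Ioo (-1 : ℝ) 0, 2 * ∫ w in (0 : ℝ)..Γl, P w ≤ Γl * P Γl := by
  rintro x ⟨hx, hx0⟩
  rw [integral_modified_kirchhoff_stress lam mu rho hP hx, hP x hx]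
  obtain ⟨t, rfl⟩ : ∃ t, x = t - 1 := ⟨x + 1, by ring⟩
  rw [add_sub_cancel]
  have ht : 0 < t := by linarith
  have ht1 : t < 1 := by linarith
  have hlm : 2 * mu ≤ lam := (le_div_iff₀ hmu).1 hratio
  have hcube : 0 ≤ (1 - t) ^ 3 := pow_nonneg (by linarith) 3
  have hlog : lam * ((1 - t) ^ 3 / 2) ≤
      lam * ((t - 1) * (Real.log t / t) - Real.log t ^ 2) :=
    mul_le_mul_of_nonneg_left (one_sub_pow_three_le_log_defect ht ht1.le) hlam.le
  have hpoly : mu * (1 + t) * ((1 - t) ^ 3 / 2) ≤ lam * ((1 - t) ^ 3 / 2) :=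
    mul_le_mul_of_nonneg_right (by nlinarith) (by linarith)
  rw [← sub_nonneg]
  calc 0 ≤ (1 / rho) * (lam * ((t - 1) * (Real.log t / t) - Real.log t ^ 2)
        - mu * (1 + t) * ((1 - t) ^ 3 / 2)) :=
        mul_nonneg (by positivity) (by linarith)
    _ = _ := by ring
end

section
/- Let λ, μ, ρ₀ > 0 and define the Ogden stress function P(Γ) = (1/ρ₀)·(λΓ + μ·(2+Γ)Γ/(Γ+1)) for Γ > −1. Then for every Γ_l ∈ (−1,0], 2·∫₀^{Γ_l} P(w) dw ≤ Γ_l · P(Γ_l); that is, the compression-shock solution S(Γ_l) satisfies the entropy condition corresponding to the standard entropy function for all Γ_l ∈ (−1,0]. -/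
/-- The secant slope through the origin of the Ogden stress is non-increasing, so on `[Γ, 0]` the
stress lies above its chord from `Γ` to `0`. -/
lemma ogden_chord_le {lam mu rho Γ w : ℝ} (hmu : 0 < mu) (hrho : 0 < rho)
    (hΓ : -1 < Γ) (hw : Γ ≤ w) (hw0 : w ≤ 0) :
    (1 / rho) * (lam + mu * (1 + 1 / (Γ + 1))) * w ≤
      (1 / rho) * (lam * w + mu * (2 + w) * w / (w + 1)) := by
  have hw1 : 0 < w + 1 := by linarith
  have hinv : 1 / (w + 1) ≤ 1 / (Γ + 1) :=
    one_div_le_one_div_of_le (by linarith) (by linarith)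
  have heq : mu * (2 + w) * w / (w + 1) = mu * (1 + 1 / (w + 1)) * w := by
    field_simp
    ring
  rw [heq, mul_assoc]
  refine mul_le_mul_of_nonneg_left ?_ (by positivity)
  nlinarith [mul_nonneg hmu.le (mul_nonneg (sub_nonneg.2 hinv) (neg_nonneg.2 hw0))]

open intervalIntegral

/-- For the Ogden stress function
`P(Γ) = (1/ρ₀)(λΓ + μ(2+Γ)Γ/(Γ+1))` with `λ, μ, ρ₀ > 0`, the compression-shock
solution satisfies the standard entropy condition `2∫₀^{Γₗ} P ≤ Γₗ · P(Γₗ)`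
for all `Γₗ ∈ (−1,0]`. -/
theorem stmt_17 (lam mu rho : ℝ) (hlam : 0 < lam) (hmu : 0 < mu) (hrho : 0 < rho)
    (P : ℝ → ℝ)
    (hP : ∀ Γ : ℝ, -1 < Γ →
      P Γ = (1 / rho) * (lam * Γ + mu * (2 + Γ) * Γ / (Γ + 1))) :
    ∀ Γl ∈ Set.Ioc (-1 : ℝ) 0, 2 * ∫ w in (0 : ℝ)..Γl, P w ≤ Γl * P Γl := by
  rintro Γl ⟨hΓ, hΓ0⟩
  have hΓ1 : Γl + 1 ≠ 0 := by linarith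
  set k := (1 / rho) * (lam + mu * (1 + 1 / (Γl + 1))) with hk
  have hPk : P Γl = k * Γl := by
    rw [hP Γl hΓ, hk]
    field_simp
    ring
  have hcont : ContinuousOn P (Set.uIcc Γl 0) := by
    rw [Set.uIcc_of_le hΓ0]
    refine ContinuousOn.congr
      (f := fun w => (1 / rho) * (lam * w + mu * (2 + w) * w / (w + 1))) ?_
      fun w hw => hP w (by linarith [hw.1])
    refine continuousOn_const.mul (ContinuousOn.add (by fun_prop) (ContinuousOn.div (by fun_prop)
      (by fun_prop) fun w hw => ?_))
    linarith [hw.1]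
  have hmono : ∫ w in Γl..0, k * w ≤ ∫ w in Γl..0, P w := by
    refine integral_mono_on hΓ0 (Continuous.intervalIntegrable (by fun_prop) _ _)
      hcont.intervalIntegrable fun w hw => ?_
    rw [hP w (by linarith [hw.1])]
    exact ogden_chord_le hmu hrho hΓ hw.1 hw.2
  rw [intervalIntegral.integral_const_mul, integral_id] at hmono
  rw [integral_symm, hPk]
  linarith
end

section
/- Let μ, ρ₀ > 0, f ∈ (0,1), β ≥ 1/2, and define the Blatz-Ko–Ogden stress function P(Γ) = (μ(1+Γ)/ρ₀)·{ f·[1 − (1+Γ)^{−2β−2}] + ((1−f)/(1+Γ)⁴)·[(1+Γ)^{2β+2} − 1] } for Γ > −1. Then P'(Γ) > 0 for all Γ > −1; that is, the corresponding p-system is strictly hyperbolic on the whole range Γ > −1. -/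
theorem blatzKoOgden_eq_sum_rpow {x : ℝ} (hx : 0 < x) (mu rho f β : ℝ) :
    (mu * x / rho) * (f * (1 - x ^ (-(2 * β) - 2)) +
        ((1 - f) / x ^ (4 : ℕ)) * (x ^ (2 * β + 2) - 1)) =
      mu / rho * (f * (x - x ^ (-(2 * β) - 1)) +
        (1 - f) * (x ^ (2 * β - 1) - x ^ (-3 : ℝ))) := by
  have h₁ : x ^ (-(2 * β) - 1) = x ^ (-(2 * β) - 2) * x := by
    rw [← Real.rpow_add_one hx.ne']; congr 1; ring
  have h₂ : x ^ (2 * β + 2) = x ^ (2 * β - 1) * x ^ (3 : ℕ) := by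
    rw [← Real.rpow_add_natCast hx.ne']; congr 1; push_cast; ring
  have h₃ : x ^ (-3 : ℝ) = (x ^ (3 : ℕ))⁻¹ := by
    rw [Real.rpow_neg hx.le]; norm_cast
  rw [h₁, h₂, h₃]
  field_simp

theorem hasDerivAt_one_add_rpow {Γ : ℝ} (hΓ : -1 < Γ) (p : ℝ) :
    HasDerivAt (fun y : ℝ => (1 + y) ^ p) (p * (1 + Γ) ^ (p - 1)) Γ := by
  have h : HasDerivAt (fun y : ℝ => 1 + y) 1 Γ := (hasDerivAt_id Γ).const_add 1
  simpa using h.rpow_const (p := p) (Or.inl (by linarith))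


/-- For the Blatz-Ko–Ogden stress function
`P(Γ) = (μ(1+Γ)/ρ₀){ f[1 − (1+Γ)^{−2β−2}] + (1−f)(1+Γ)^{−4}[(1+Γ)^{2β+2} − 1] }`
with `μ, ρ₀ > 0`, `f ∈ (0,1)` and `β ≥ 1/2`: `P'(Γ) > 0` for all `Γ > −1`
(strict hyperbolicity on the whole range). Real powers are `Real.rpow`. -/
theorem stmt_18 (mu rho f β : ℝ) (hmu : 0 < mu) (hrho : 0 < rho)
    (hf : f ∈ Set.Ioo (0 : ℝ) 1) (hβ : 1 / 2 ≤ β)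
    (P : ℝ → ℝ)
    (hP : ∀ Γ : ℝ, -1 < Γ →
      P Γ = (mu * (1 + Γ) / rho) *
        (f * (1 - (1 + Γ) ^ (-(2 * β) - 2)) +
          ((1 - f) / (1 + Γ) ^ (4 : ℕ)) * ((1 + Γ) ^ (2 * β + 2) - 1))) :
    ∀ Γ : ℝ, -1 < Γ → 0 < deriv P Γ := by
  intro Γ hΓ
  obtain ⟨hf₀, hf₁⟩ := hf
  have hx : 0 < 1 + Γ := by linarith
  have hEq : P =ᶠ[nhds Γ] fun y => mu / rho * (f * ((1 + y) - (1 + y) ^ (-(2 * β) - 1)) +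
      (1 - f) * ((1 + y) ^ (2 * β - 1) - (1 + y) ^ (-3 : ℝ))) := by
    filter_upwards [lt_mem_nhds hΓ] with y hy
    rw [hP y hy, blatzKoOgden_eq_sum_rpow (by linarith)]
  have hD := (((((hasDerivAt_id Γ).const_add 1).sub
    (hasDerivAt_one_add_rpow hΓ (-(2 * β) - 1))).const_mul f).add
    (((hasDerivAt_one_add_rpow hΓ (2 * β - 1)).sub
    (hasDerivAt_one_add_rpow hΓ (-3))).const_mul (1 - f))).const_mul (mu / rho)
  rw [(hD.congr_of_eventuallyEq hEq).deriv]
  have h₁ := Real.rpow_pos_of_pos hx (-(2 * β) - 1 - 1)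
  have h₂ := Real.rpow_pos_of_pos hx (2 * β - 1 - 1)
  have h₃ := Real.rpow_pos_of_pos hx (-3 - 1)
  have hA : 0 < 1 - (-(2 * β) - 1) * (1 + Γ) ^ (-(2 * β) - 1 - 1) := by
    linarith [mul_pos (show 0 < 2 * β + 1 by linarith) h₁]
  have hB : 0 < (2 * β - 1) * (1 + Γ) ^ (2 * β - 1 - 1) - -3 * (1 + Γ) ^ (-3 - 1 : ℝ) := by
    linarith [mul_nonneg (show 0 ≤ 2 * β - 1 by linarith) h₂.le]
  exact mul_pos (div_pos hmu hrho)
    (add_pos (mul_pos hf₀ hA) (mul_pos (sub_pos.2 hf₁) hB))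
end

section
/- Let μ, ρ₀ > 0, f ∈ (0,1), and 0 < β ≤ 5/2, and define the Blatz-Ko–Ogden stress function P(Γ) = (μ(1+Γ)/ρ₀)·{ f·[1 − (1+Γ)^{−2β−2}] + ((1−f)/(1+Γ)⁴)·[(1+Γ)^{2β+2} − 1] } for Γ > −1. Then P''(Γ) < 0 for all Γ ∈ (−1,0], and consequently for every Γ_l ∈ (−1,0], 2·∫₀^{Γ_l} P(w) dw ≤ Γ_l · P(Γ_l); that is, the compression-shock solution S(Γ_l) satisfies the entropy condition corresponding to the standard entropy function for all Γ_l ∈ (−1,0]. -/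
open intervalIntegral

/-- The Blatz-Ko–Ogden stress in terms of the stretch `x = 1 + Γ`, as a combination of powers. -/
noncomputable def stretchStress (c f β x : ℝ) : ℝ :=
  c * (f * (x - x ^ (-(2 * β) - 1)) + (1 - f) * (x ^ (2 * β - 1) - x ^ (-3 : ℝ)))

lemma stress_eq_stretchStress (mu rho f β : ℝ) {x : ℝ} (hx : 0 < x) :
    (mu * x / rho) * (f * (1 - x ^ (-(2 * β) - 2)) +
      ((1 - f) / x ^ (4 : ℕ)) * (x ^ (2 * β + 2) - 1)) =
    stretchStress (mu / rho) f β x := by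
  have h1 : x ^ (-(2 * β) - 1) = x ^ (-(2 * β) - 2) * x := by
    rw [← Real.rpow_add_one hx.ne']; ring_nf
  have h2 : x ^ (2 * β - 1) * x ^ (3 : ℕ) = x ^ (2 * β + 2) := by
    rw [← Real.rpow_add_natCast hx.ne']; norm_num; ring_nf
  have h3 : x ^ (-3 : ℝ) = (x ^ (3 : ℕ))⁻¹ := by
    rw [Real.rpow_neg hx.le]; norm_cast
  rw [stretchStress, h1, h3, ← h2]
  field_simp

lemma hasDerivAt_stretchStress (c f β : ℝ) {x : ℝ} (hx : 0 < x) :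
    HasDerivAt (stretchStress c f β)
      (c * (f * (1 - (-(2 * β) - 1) * x ^ (-(2 * β) - 2)) +
        (1 - f) * ((2 * β - 1) * x ^ (2 * β - 2) - (-3) * x ^ (-4 : ℝ)))) x := by
  have h (r : ℝ) := Real.hasDerivAt_rpow_const (p := r) (Or.inl hx.ne')
  refine HasDerivAt.congr_deriv (((((hasDerivAt_id x).sub (h (-(2 * β) - 1))).const_mul f).add
    (((h (2 * β - 1)).sub (h (-3))).const_mul (1 - f))).const_mul c) ?_
  ring_nf

lemma hasDerivAt_deriv_stretchStress (c f β : ℝ) {x : ℝ} (hx : 0 < x) :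
    HasDerivAt (deriv (stretchStress c f β))
      (c * (f * (-((2 * β + 1) * (2 * β + 2)) * x ^ (-(2 * β) - 3)) +
        (1 - f) * ((2 * β - 1) * (2 * β - 2) * x ^ (2 * β - 3) - 12 * x ^ (-5 : ℝ)))) x := by
  have h (r : ℝ) := Real.hasDerivAt_rpow_const (p := r) (Or.inl hx.ne')
  have key := (((((h (-(2 * β) - 2)).const_mul (-(2 * β) - 1)).const_sub 1).const_mul f).add
    ((((h (2 * β - 2)).const_mul (2 * β - 1)).sub
      ((h (-4)).const_mul (-3))).const_mul (1 - f))).const_mul c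
  refine (key.congr_of_eventuallyEq ?_).congr_deriv ?_
  · filter_upwards [eventually_gt_nhds hx] with y hy
    exact (hasDerivAt_stretchStress c f β hy).deriv
  · ring_nf

lemma deriv_deriv_stretchStress_neg {c f β x : ℝ} (hc : 0 < c) (hf : f ∈ Set.Ioo (0 : ℝ) 1)
    (hβ0 : 0 < β) (hβ : β ≤ 5 / 2) (hx : x ∈ Set.Ioc (0 : ℝ) 1) :
    deriv (deriv (stretchStress c f β)) x < 0 := by
  rw [(hasDerivAt_deriv_stretchStress c f β hx.1).deriv]
  have h1 : 0 < x ^ (-(2 * β) - 3) := Real.rpow_pos_of_pos hx.1 _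
  have h2 : 0 < x ^ (2 * β - 3) := Real.rpow_pos_of_pos hx.1 _
  have h3 : x ^ (2 * β - 3) ≤ x ^ (-5 : ℝ) :=
    Real.rpow_le_rpow_of_exponent_ge hx.1 hx.2 (by linarith)
  have h4 : (2 * β - 1) * (2 * β - 2) ≤ 12 := by nlinarith
  have h5 : 0 < f * ((2 * β + 1) * (2 * β + 2) * x ^ (-(2 * β) - 3)) :=
    mul_pos hf.1 (by positivity)
  have h6 : (2 * β - 1) * (2 * β - 2) * x ^ (2 * β - 3) - 12 * x ^ (-5 : ℝ) ≤ 0 := by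
    linarith [mul_le_mul_of_nonneg_right h4 h2.le]
  have h7 := mul_nonpos_of_nonneg_of_nonpos (sub_nonneg.2 hf.2.le) h6
  exact mul_neg_of_pos_of_neg hc (by linarith)

/-- Trapezoidal bound for a function that is concave to the left of a zero at the origin. -/
lemma ConcaveOn.two_mul_integral_le_mul {P : ℝ → ℝ} {a : ℝ} (ha : a ≤ 0)
    (hP : ConcaveOn ℝ (Set.Icc a 0) P) (hcont : ContinuousOn P (Set.Icc a 0)) (h0 : P 0 = 0) :
    2 * ∫ w in (0 : ℝ)..a, P w ≤ a * P a := by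
  rcases ha.eq_or_lt with rfl | ha'
  · simp
  have hchord : ∀ w ∈ Set.Icc a 0, w * (P a / a) ≤ P w := by
    intro w hw
    have hs : 0 ≤ w / a := div_nonneg_of_nonpos hw.2 ha
    have hs1 : w / a ≤ 1 := (div_le_one_of_neg ha').2 hw.1
    have h := hP.2 (Set.left_mem_Icc.2 ha) (Set.right_mem_Icc.2 ha) hs (sub_nonneg.2 hs1)
      (add_sub_cancel _ _)
    simp only [smul_eq_mul, h0, mul_zero, add_zero, div_mul_cancel₀ w ha'.ne] at h
    calc w * (P a / a) = w / a * P a := by ring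
      _ ≤ P w := h
  have hint := integral_mono_on (μ := MeasureTheory.volume) ha
    ((by fun_prop : Continuous fun w => w * (P a / a)).intervalIntegrable a 0)
    (hcont.intervalIntegrable_of_Icc ha) hchord
  have hval : ∫ w in a..0, w * (P a / a) = -(a * P a) / 2 := by
    rw [integral_mul_const, integral_id]
    field_simp [ha'.ne]
    ring
  rw [hval] at hint
  rw [integral_symm]
  linarith

/-- For the Blatz-Ko–Ogden stress function
`P(Γ) = (μ(1+Γ)/ρ₀){ f[1 − (1+Γ)^{−2β−2}] + (1−f)(1+Γ)^{−4}[(1+Γ)^{2β+2} − 1] }`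
with `μ, ρ₀ > 0`, `f ∈ (0,1)` and `0 < β ≤ 5/2`: `P''(Γ) < 0` on `(−1,0]`, and
consequently the standard entropy condition `2∫₀^{Γₗ} P ≤ Γₗ · P(Γₗ)` holds for
all `Γₗ ∈ (−1,0]`. -/
theorem stmt_19 (mu rho f β : ℝ) (hmu : 0 < mu) (hrho : 0 < rho)
    (hf : f ∈ Set.Ioo (0 : ℝ) 1) (hβ0 : 0 < β) (hβ : β ≤ 5 / 2)
    (P : ℝ → ℝ)
    (hP : ∀ Γ : ℝ, -1 < Γ →
      P Γ = (mu * (1 + Γ) / rho) *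
        (f * (1 - (1 + Γ) ^ (-(2 * β) - 2)) +
          ((1 - f) / (1 + Γ) ^ (4 : ℕ)) * ((1 + Γ) ^ (2 * β + 2) - 1))) :
    (∀ Γ ∈ Set.Ioc (-1 : ℝ) 0, deriv (deriv P) Γ < 0) ∧
      (∀ Γl ∈ Set.Ioc (-1 : ℝ) 0, 2 * ∫ w in (0 : ℝ)..Γl, P w ≤ Γl * P Γl) := by
  have heq : ∀ Γ : ℝ, -1 < Γ → P Γ = stretchStress (mu / rho) f β (Γ + 1) := fun Γ hΓ => by
    rw [hP Γ hΓ, stress_eq_stretchStress mu rho f β (by linarith), add_comm]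
  have heq_nhds : ∀ Γ : ℝ, -1 < Γ →
      P =ᶠ[nhds Γ] fun y => stretchStress (mu / rho) f β (y + 1) := fun Γ hΓ =>
    (eventually_gt_nhds hΓ).mono heq
  have hneg : ∀ Γ ∈ Set.Ioc (-1 : ℝ) 0, deriv (deriv P) Γ < 0 := by
    intro Γ hΓ
    have hshift : deriv (fun y => stretchStress (mu / rho) f β (y + 1)) =
        fun y => deriv (stretchStress (mu / rho) f β) (y + 1) :=
      funext fun y => deriv_comp_add_const _ _ y
    rw [(heq_nhds Γ hΓ.1).deriv.deriv_eq, hshift, deriv_comp_add_const]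
    exact deriv_deriv_stretchStress_neg (div_pos hmu hrho) hf hβ0 hβ
      ⟨by linarith [hΓ.1], by linarith [hΓ.2]⟩
  have hcont : ContinuousOn P (Set.Ioc (-1) 0) := fun Γ hΓ =>
    (((hasDerivAt_stretchStress (mu / rho) f β
      (by linarith [hΓ.1] : 0 < Γ + 1)).comp_add_const Γ 1).continuousAt.congr
        (heq_nhds Γ hΓ.1).symm).continuousWithinAt
  refine ⟨hneg, fun Γl hΓl => ?_⟩
  have hsub : Set.Icc Γl 0 ⊆ Set.Ioc (-1) 0 := Set.Icc_subset_Ioc hΓl.1 le_rfl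
  exact ConcaveOn.two_mul_integral_le_mul hΓl.2
    ((strictConcaveOn_of_deriv2_neg' (convex_Ioc _ _) hcont hneg).concaveOn.subset hsub
      (convex_Icc _ _)) (hcont.mono hsub) (by rw [hP 0 (by norm_num)]; simp)
end
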